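/- arXiv:1009.4168 — 7 statements merged into one kernel-verified Lean document; each statement's English description precedes it below -/
import Mathlib

section
/- For every integer m ≥ 1 there is a unique real number x in the open interval ((2m−1)π/2, mπ) satisfying cos x + x · sin x = 0 (equivalently cot x = −x), and moreover every positive real solution of cos x + x · sin x = 0 lies in one of the intervals ((2m−1)π/2, mπ) for some integer m ≥ 1. -/
/-- Reflecting `t = mπ - s` turns the secular equation into `cos s = (mπ - s) sin s`. -/
theorem cos_add_mul_sin_eq_zero_iff_reflect (m : ℕ) (t : ℝ) :
    Real.cos t + t * Real.sin t = 0 ↔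
      Real.cos (m * Real.pi - t) - t * Real.sin (m * Real.pi - t) = 0 := by
  rw [Real.cos_nat_mul_pi_sub, Real.sin_nat_mul_pi_sub]
  have h : (-1 : ℝ) ^ m ≠ 0 := pow_ne_zero _ (by norm_num)
  have e : (-1 : ℝ) ^ m * Real.cos t - t * -((-1) ^ m * Real.sin t) =
      (-1) ^ m * (Real.cos t + t * Real.sin t) := by ring
  rw [e, mul_eq_zero, or_iff_right h]

theorem strictAntiOn_cos_sub_mul_sin {a : ℝ} (ha : Real.pi / 2 ≤ a) :
    StrictAntiOn (fun s : ℝ => Real.cos s - (a - s) * Real.sin s) (Set.Icc 0 (Real.pi / 2)) := by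
  refine strictAntiOn_of_deriv_neg (convex_Icc _ _) (by fun_prop) fun s hs => ?_
  rw [interior_Icc] at hs
  have hd : HasDerivAt (fun s : ℝ => Real.cos s - (a - s) * Real.sin s)
      (-((a - s) * Real.cos s)) s := by
    refine ((Real.hasDerivAt_cos s).sub
      (((hasDerivAt_id s).const_sub a).mul (Real.hasDerivAt_sin s))).congr_deriv ?_
    simp only [id]
    ring
  rw [hd.deriv, neg_lt_zero]
  exact mul_pos (by linarith [hs.2]) (Real.cos_pos_of_mem_Ioo ⟨by linarith [hs.1, hs.2], hs.2⟩)


/-- For every `m ≥ 1` there is a unique root of `cos x + x sin x = 0`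
(equivalently `cot x = -x`) in the interval `((2m-1)π/2, mπ)`, and every
positive root lies in one of these intervals. -/
theorem roots_of_secular_equation_localization :
    (∀ m : ℕ, 1 ≤ m →
      ∃! t : ℝ, t ∈ Set.Ioo ((2 * (m : ℝ) - 1) * Real.pi / 2) ((m : ℝ) * Real.pi) ∧
        Real.cos t + t * Real.sin t = 0) ∧
    (∀ t : ℝ, 0 < t → Real.cos t + t * Real.sin t = 0 →
      ∃ m : ℕ, 1 ≤ m ∧
        t ∈ Set.Ioo ((2 * (m : ℝ) - 1) * Real.pi / 2) ((m : ℝ) * Real.pi)) := by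
  have hpi := Real.pi_pos
  refine ⟨fun m hm => ?_, fun t ht h => ?_⟩
  · have hm1 : (1 : ℝ) ≤ m := by exact_mod_cast hm
    have hmpi : Real.pi ≤ m * Real.pi := le_mul_of_one_le_left hpi.le hm1
    have hanti := strictAntiOn_cos_sub_mul_sin (a := m * Real.pi) (by linarith)
    obtain ⟨s, hs, hs0⟩ : (0 : ℝ) ∈ (fun s : ℝ => Real.cos s - (m * Real.pi - s) * Real.sin s) ''
        Set.Ioo 0 (Real.pi / 2) := by
      refine intermediate_value_Ioo' (by linarith) (by fun_prop) ⟨?_, ?_⟩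
      · simp only [Real.cos_pi_div_two, Real.sin_pi_div_two]
        linarith
      · simp
    refine ⟨m * Real.pi - s, ⟨⟨by linarith [hs.2], by linarith [hs.1]⟩, ?_⟩, ?_⟩
    · rw [cos_add_mul_sin_eq_zero_iff_reflect m, sub_sub_cancel]
      exact hs0
    · rintro t ⟨⟨h1, h2⟩, h0⟩
      rw [cos_add_mul_sin_eq_zero_iff_reflect m] at h0
      have := hanti.injOn (x₁ := m * Real.pi - t) (x₂ := s) ⟨by linarith, by linarith⟩
        (Set.Ioo_subset_Icc_self hs) (by simpa only [sub_sub_cancel] using h0.trans hs0.symm)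
      linarith
  · refine ⟨⌊t / Real.pi⌋₊ + 1, by omega, ?_⟩
    have h1 : (⌊t / Real.pi⌋₊ : ℝ) * Real.pi ≤ t :=
      (le_div_iff₀ hpi).1 (Nat.floor_le (by positivity))
    have h2 : t < ((⌊t / Real.pi⌋₊ + 1 : ℕ) : ℝ) * Real.pi := by
      push_cast
      exact (div_lt_iff₀ hpi).1 (Nat.lt_floor_add_one _)
    refine ⟨?_, h2⟩
    rw [cos_add_mul_sin_eq_zero_iff_reflect (⌊t / Real.pi⌋₊ + 1)] at h
    by_contra! hle
    set s := ((⌊t / Real.pi⌋₊ + 1 : ℕ) : ℝ) * Real.pi - t with hs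
    have hs2 : Real.pi / 2 ≤ s := by linarith
    have hspi : s ≤ Real.pi := by
      rw [hs]
      push_cast
      linarith
    have hcos : Real.cos s ≤ 0 := Real.cos_nonpos_of_pi_div_two_le_of_le hs2 (by linarith)
    have hsin : 0 ≤ Real.sin s := Real.sin_nonneg_of_nonneg_of_le_pi (by linarith) hspi
    have hmul : 0 ≤ t * Real.sin s := mul_nonneg ht.le hsin
    have hcos0 : Real.cos s = 0 := by linarith
    have hsin0 : Real.sin s = 0 := by
      have : t * Real.sin s = 0 := by linarith
      exact (mul_eq_zero.1 this).resolve_left ht.ne'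
    simpa [hcos0, hsin0] using Real.sin_sq_add_cos_sq s
end

section
/- Let μ be a nonzero real number and let φ : [0,1] → ℝ be a continuous function satisfying μ·φ(x) = −(1/2)·∫₀¹ |x−y|·φ(y) dy for all x ∈ [0,1]. Then φ is twice continuously differentiable on [0,1], it satisfies −φ''(x) = (1/μ)·φ(x) for all x ∈ (0,1), and it satisfies the non-local boundary conditions φ(0)+φ(1) = −φ'(0) and φ(0)+φ(1) = φ'(1). -/
open Set intervalIntegral in
/-- The integral of `|x - y| ψ y` in terms of the primitives of `ψ y` and `y ψ y`. -/
theorem integral_abs_sub_mul {ψ : ℝ → ℝ} (hψ : Continuous ψ) {a b x : ℝ} (hx : x ∈ Icc a b) :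
    ∫ y in a..b, |x - y| * ψ y =
      2 * (x * (∫ y in a..x, ψ y) - ∫ y in a..x, y * ψ y)
        + (∫ y in a..b, y * ψ y) - x * ∫ y in a..b, ψ y := by
  have hi : ∀ c d, IntervalIntegrable ψ MeasureTheory.volume c d :=
    fun c d => hψ.intervalIntegrable c d
  have hj : ∀ c d, IntervalIntegrable (fun y => y * ψ y) MeasureTheory.volume c d :=
    fun c d => (continuous_id.mul hψ).intervalIntegrable c d
  have hk : ∀ c d, IntervalIntegrable (fun y => |x - y| * ψ y) MeasureTheory.volume c d :=
    fun c d => ((by fun_prop : Continuous fun y => |x - y| * ψ y)).intervalIntegrable c d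
  have hleft : ∫ y in a..x, |x - y| * ψ y = x * (∫ y in a..x, ψ y) - ∫ y in a..x, y * ψ y := by
    rw [← integral_const_mul, ← integral_sub ((hi a x).const_mul x) (hj a x)]
    refine integral_congr fun y hy => ?_
    rw [uIcc_of_le hx.1] at hy
    simp only [abs_of_nonneg (sub_nonneg.2 hy.2)]
    ring
  have hright : ∫ y in x..b, |x - y| * ψ y = (∫ y in x..b, y * ψ y) - x * ∫ y in x..b, ψ y := by
    rw [← integral_const_mul, ← integral_sub (hj x b) ((hi x b).const_mul x)]
    refine integral_congr fun y hy => ?_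
    rw [uIcc_of_le hx.2] at hy
    simp only [abs_of_nonpos (sub_nonpos.2 hy.1)]
    ring
  rw [← integral_add_adjacent_intervals (hk a x) (hk x b), hleft, hright,
    ← integral_add_adjacent_intervals (hi a x) (hi x b),
    ← integral_add_adjacent_intervals (hj a x) (hj x b)]
  ring

/-- A function with a continuous second derivative is of class `C²`. -/
theorem contDiff_two_of_hasDerivAt {f f' f'' : ℝ → ℝ} (hf : ∀ x, HasDerivAt f (f' x) x)
    (hf' : ∀ x, HasDerivAt f' (f'' x) x) (hf'' : Continuous f'') : ContDiff ℝ 2 f := by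
  have h1 : deriv f = f' := funext fun x => (hf x).deriv
  have h2 : deriv f' = f'' := funext fun x => (hf' x).deriv
  have hf'_contDiff : ContDiff ℝ 1 f' :=
    contDiff_one_iff_deriv.2 ⟨fun x => (hf' x).differentiableAt, h2 ▸ hf''⟩
  rw [show (2 : WithTop ℕ∞) = 1 + 1 by norm_num, contDiff_succ_iff_deriv]
  exact ⟨fun x => (hf x).differentiableAt, by simp, h1 ▸ hf'_contDiff⟩


/-- An eigenfunction of the integral operator with kernel `K(x,y) = -|x-y|/2`
on `(0,1)` with nonzero eigenvalue `μ` is twice continuously differentiable,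
satisfies `-φ'' = (1/μ) φ` on `(0,1)`, and satisfies the non-local boundary
conditions `φ(0) + φ(1) = -φ'(0) = φ'(1)`. -/
theorem integral_operator_eigenfunction_solves_nonlocal_bvp
    (μ : ℝ) (hμ : μ ≠ 0) (φ : ℝ → ℝ)
    (hcont : ContinuousOn φ (Set.Icc 0 1))
    (heig : ∀ x ∈ Set.Icc (0 : ℝ) 1,
      μ * φ x = -(1 / 2) * ∫ y in (0 : ℝ)..1, |x - y| * φ y) :
    ContDiffOn ℝ 2 φ (Set.Icc 0 1) ∧
    (∀ x ∈ Set.Ioo (0 : ℝ) 1,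
      -(derivWithin (derivWithin φ (Set.Icc 0 1)) (Set.Icc 0 1) x) = (1 / μ) * φ x) ∧
    φ 0 + φ 1 = -(derivWithin φ (Set.Icc 0 1) 0) ∧
    φ 0 + φ 1 = derivWithin φ (Set.Icc 0 1) 1 := by
  obtain ⟨ψ, hψ, hψφ⟩ : ∃ ψ : ℝ → ℝ, Continuous ψ ∧ Set.EqOn ψ φ (Set.Icc 0 1) :=
    ⟨Set.IccExtend zero_le_one ((Set.Icc (0 : ℝ) 1).domRestrict φ), hcont.domRestrict.Icc_extend',
      fun x hx => Set.IccExtend_of_mem _ _ hx⟩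
  set A : ℝ → ℝ := fun x => ∫ y in (0 : ℝ)..x, ψ y with hA
  set B : ℝ → ℝ := fun x => ∫ y in (0 : ℝ)..x, y * ψ y with hB
  set G : ℝ → ℝ := fun x => -(1 / (2 * μ)) * (2 * (x * A x - B x) + B 1 - x * A 1) with hG
  set G' : ℝ → ℝ := fun x => -(1 / (2 * μ)) * (2 * A x - A 1) with hG'
  have hφG : Set.EqOn φ G (Set.Icc 0 1) := by
    intro x hx
    have hcongr : ∫ y in (0 : ℝ)..1, |x - y| * φ y = ∫ y in (0 : ℝ)..1, |x - y| * ψ y := by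
      refine intervalIntegral.integral_congr fun y hy => ?_
      rw [Set.uIcc_of_le zero_le_one] at hy
      simp only [hψφ hy]
    have h := heig x hx
    rw [hcongr, integral_abs_sub_mul hψ hx] at h
    apply mul_left_cancel₀ hμ
    rw [h]
    simp only [hG, hA, hB]
    field_simp
  have hAd : ∀ x, HasDerivAt A (ψ x) x := fun x => hψ.integral_hasStrictDerivAt 0 x |>.hasDerivAt
  have hBd : ∀ x, HasDerivAt B (x * ψ x) x := fun x =>
    (continuous_id.mul hψ).integral_hasStrictDerivAt 0 x |>.hasDerivAt
  have hGd : ∀ x, HasDerivAt G (G' x) x := by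
    intro x
    refine (((((((hasDerivAt_id x).mul (hAd x)).sub (hBd x)).const_mul 2).add_const (B 1)).sub
      ((hasDerivAt_id x).mul_const (A 1))).const_mul (-(1 / (2 * μ)))).congr_deriv ?_
    simp only [hG', id]
    ring
  have hG'd : ∀ x, HasDerivAt G' (-(1 / μ) * ψ x) x := by
    intro x
    refine ((((hAd x).const_mul 2).sub_const (A 1)).const_mul (-(1 / (2 * μ)))).congr_deriv ?_
    field_simp
  have hud := uniqueDiffOn_Icc (zero_lt_one (α := ℝ))
  have hφ' : Set.EqOn (derivWithin φ (Set.Icc 0 1)) G' (Set.Icc 0 1) := fun x hx =>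
    (((hGd x).hasDerivWithinAt).congr_of_mem hφG hx).derivWithin (hud x hx)
  have h0 : (0 : ℝ) ∈ Set.Icc (0 : ℝ) 1 := by simp
  have h1 : (1 : ℝ) ∈ Set.Icc (0 : ℝ) 1 := by simp
  have hA0 : A 0 = 0 := intervalIntegral.integral_same
  have hB0 : B 0 = 0 := intervalIntegral.integral_same
  refine ⟨?_, ?_, ?_, ?_⟩
  · exact (contDiff_two_of_hasDerivAt hGd hG'd (hψ.const_mul _)).contDiffOn.congr hφG
  · intro x hx
    have hx' := Set.Ioo_subset_Icc_self hx
    rw [(((hG'd x).hasDerivWithinAt).congr_of_mem hφ' hx').derivWithin (hud x hx'), hψφ hx']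
    ring
  · rw [hφ' h0, hφG h0, hφG h1]
    simp only [hG, hG', hA0, hB0]
    ring
  · rw [hφ' h1, hφG h0, hφG h1]
    simp only [hG, hG', hA0, hB0]
    ring
end

section
/- Let α be the unique positive real number satisfying cosh α = α · sinh α, and let (x_m)_{m≥1} be the strictly increasing enumeration of the positive solutions of cos x + x·sin x = 0. Then for every real number x, the infinite product (1 + x²/α²) · ∏_{m=1}^∞ (1 − x²/x_m²) converges and equals cos x + x · sin x. -/
open Filter Topology Finset

/-- The squares `((k + 1/2) π)²` of the positive zeros of the cosine. -/
noncomputable def cosZeroSq (k : ℕ) : ℝ := ((k + 1 / 2) * Real.pi) ^ 2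

/-- A partial Mittag-Leffler sum: for `A = cosZeroSq` and `t = x²` it tends to `1 + x tan x`. -/
noncomputable def oneAddPoleSum (A : ℕ → ℝ) (n : ℕ) (t : ℝ) : ℝ :=
  1 + ∑ k ∈ range n, 2 * t / (A k - t)

lemma Complex.mem_integerComplement_of_sin_pi_mul_ne_zero {w : ℂ}
    (hw : Complex.sin (Real.pi * w) ≠ 0) : w ∈ Complex.integerComplement := by
  rw [Complex.mem_integerComplement_iff]
  rintro ⟨n, rfl⟩
  exact hw (by rw [mul_comm]; exact Complex.sin_int_mul_pi n)

lemma sum_range_two_mul {M : Type*} [AddCommMonoid M] (f : ℕ → M) (n : ℕ) :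
    ∑ k ∈ range (2 * n), f k =
      ∑ k ∈ range n, f (2 * k) + ∑ k ∈ range n, f (2 * k + 1) := by
  induction n with
  | zero => simp
  | succ n ih =>
    rw [Nat.mul_succ, sum_range_succ, sum_range_succ, ih, sum_range_succ, sum_range_succ]
    abel

lemma prod_range_two_mul {M : Type*} [CommMonoid M] (f : ℕ → M) (n : ℕ) :
    ∏ k ∈ range (2 * n), f k =
      (∏ k ∈ range n, f (2 * k)) * ∏ k ∈ range n, f (2 * k + 1) :=
  sum_range_two_mul (M := Additive M) f n

lemma tendsto_sum_tan {z : ℂ} (hz : Complex.sin (2 * z) ≠ 0) :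
    Tendsto (fun n : ℕ => ∑ k ∈ range n, 2 * z ^ 2 / ((((k : ℂ) + 1 / 2) * Real.pi) ^ 2 - z ^ 2))
      atTop (𝓝 (z * Complex.tan z)) := by
  have hpi : (Real.pi : ℂ) ≠ 0 := by exact_mod_cast Real.pi_ne_zero
  obtain ⟨w, rfl⟩ : ∃ w : ℂ, z = Real.pi * w := ⟨z / Real.pi, by field_simp⟩
  have hs : Complex.sin (Real.pi * w) ≠ 0 := by
    intro h; apply hz; rw [Complex.sin_two_mul, h]; ring
  have hc : Complex.cos (Real.pi * w) ≠ 0 := by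
    intro h; apply hz; rw [Complex.sin_two_mul, h]; ring
  have h2w : 2 * w ∈ Complex.integerComplement :=
    Complex.mem_integerComplement_of_sin_pi_mul_ne_zero
      (by rwa [show (Real.pi : ℂ) * (2 * w) = 2 * (Real.pi * w) by ring])
  have hw := Complex.mem_integerComplement_of_sin_pi_mul_ne_zero hs
  have hw0 := Complex.integerComplement.ne_zero hw
  have h1 := (tendsto_logDeriv_euler_cot_sub h2w).comp
    (tendsto_id.const_mul_atTop' (zero_lt_two : (0 : ℕ) < 2))
  have h2 := (tendsto_logDeriv_euler_cot_sub hw).const_mul (1 / 2 : ℂ)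
  have h3 := (h1.sub h2).const_mul (-2 * w)
  refine (h3.congr fun n => ?_).trans_eq ?_
  · simp only [Function.comp_apply, id]
    rw [sum_range_two_mul, mul_sum, add_sub_assoc, ← sum_sub_distrib, ← sum_add_distrib, mul_sum]
    refine sum_congr rfl fun k _ => ?_
    have e1 : 2 * w + (2 * k + 1) ≠ 0 := by
      simpa using Complex.integerComplement_add_ne_zero h2w (2 * k + 1)
    have e2 : 2 * w - (2 * k + 1) ≠ 0 := by
      have := Complex.integerComplement_add_ne_zero h2w (-(2 * k + 1))
      push_cast at this
      rwa [← sub_eq_add_neg] at this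
    have e3 : w + (k + 1) ≠ 0 := by
      simpa using Complex.integerComplement_add_ne_zero hw (k + 1)
    have e4 : w - (k + 1) ≠ 0 := by
      have := Complex.integerComplement_add_ne_zero hw (-(k + 1))
      push_cast at this
      rwa [← sub_eq_add_neg] at this
    have e5 : (((k : ℂ) + 1 / 2) * Real.pi) ^ 2 - (Real.pi * w) ^ 2 =
        - (Real.pi ^ 2 / 4 * ((2 * w + (2 * k + 1)) * (2 * w - (2 * k + 1)))) := by ring
    have e6 : cotTerm (2 * w) (2 * k + 1) = 1 / 2 * cotTerm w k := by
      have e7 : 2 * w - ((2 * k + 1 : ℕ) + 1) = 2 * (w - (k + 1)) := by push_cast; ring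
      have e8 : 2 * w + ((2 * k + 1 : ℕ) + 1) = 2 * (w + (k + 1)) := by push_cast; ring
      simp only [cotTerm]
      rw [e7, e8]
      field_simp
    rw [e6, e5, sub_self, add_zero]
    simp only [cotTerm]
    push_cast
    field_simp
    ring
  · congr 1
    rw [Complex.tan, Complex.cot, Complex.cot,
      show (Real.pi : ℂ) * (2 * w) = 2 * (Real.pi * w) by ring, Complex.sin_two_mul,
      Complex.cos_two_mul']
    generalize Complex.sin (Real.pi * w) = S at *
    generalize Complex.cos (Real.pi * w) = C at *
    field_simp
    ring

lemma tendsto_prod_cos {x : ℝ} (hx : Real.sin x ≠ 0) :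
    Tendsto (fun n : ℕ => ∏ k ∈ range n, (1 - x ^ 2 / cosZeroSq k)) atTop (𝓝 (Real.cos x)) := by
  obtain ⟨w, rfl⟩ : ∃ w : ℝ, x = Real.pi * w := ⟨x / Real.pi, by field_simp⟩
  have h1 := (Real.tendsto_euler_sin_prod (2 * w)).comp
    (tendsto_id.const_mul_atTop' (zero_lt_two : (0 : ℕ) < 2))
  have h2 := Real.tendsto_euler_sin_prod w
  have h3 := ((h1.div h2 hx).const_mul (1 / 2 : ℝ))
  have hne := h2.eventually_ne hx
  refine (h3.congr' ?_).trans_eq ?_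
  · filter_upwards [hne] with n hn
    simp only [Function.comp_apply, id, Pi.div_apply]
    rw [prod_range_two_mul, mul_div_assoc', div_eq_iff hn]
    have e1 : ∀ k : ℕ, 1 - (2 * w) ^ 2 / (((2 * k : ℕ) : ℝ) + 1) ^ 2 =
        1 - (Real.pi * w) ^ 2 / cosZeroSq k := by
      intro k
      rw [cosZeroSq]
      have := Real.pi_ne_zero
      have h : (2 * (k : ℝ) + 1) ≠ 0 := by positivity
      rw [show (k : ℝ) + 1 / 2 = (2 * k + 1) / 2 by ring]
      push_cast
      field_simp
    have e2 : ∀ k : ℕ, 1 - (2 * w) ^ 2 / (((2 * k + 1 : ℕ) : ℝ) + 1) ^ 2 =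
        1 - w ^ 2 / ((k : ℝ) + 1) ^ 2 := by
      intro k
      have h : (k : ℝ) + 1 ≠ 0 := by positivity
      rw [show ((2 * k + 1 : ℕ) : ℝ) + 1 = 2 * (k + 1) by push_cast; ring]
      field_simp
    simp only [e1, e2]
    ring
  · congr 1
    rw [show Real.pi * (2 * w) = 2 * (Real.pi * w) by ring, Real.sin_two_mul]
    field_simp

lemma tendsto_oneAddPoleSum_sq {x : ℝ} (hx : Real.sin (2 * x) ≠ 0) :
    Tendsto (fun n => oneAddPoleSum cosZeroSq n (x ^ 2)) atTop (𝓝 (1 + x * Real.tan x)) := by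
  have h := tendsto_sum_tan (z := x) (by exact_mod_cast hx)
  have h' := ((Complex.continuous_re.tendsto _).comp h).const_add 1
  refine (h'.congr fun n => ?_).trans_eq ?_
  · simp only [oneAddPoleSum, cosZeroSq, Function.comp_apply]
    congr 1
    rw [← Complex.ofReal_re (∑ k ∈ range n, _)]
    push_cast
    rfl
  · congr 2
    rw [← Complex.ofReal_tan, ← Complex.ofReal_mul, Complex.ofReal_re]

lemma tendsto_oneAddPoleSum_neg_sq {y : ℝ} (hy : y ≠ 0) :
    Tendsto (fun n => oneAddPoleSum cosZeroSq n (-y ^ 2)) atTop (𝓝 (1 - y * Real.tanh y)) := by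
  have h := tendsto_sum_tan (z := y * Complex.I) (by
    rw [← mul_assoc, Complex.sin_mul_I]
    refine mul_ne_zero ?_ Complex.I_ne_zero
    exact_mod_cast Real.sinh_ne_zero.2 (mul_ne_zero two_ne_zero hy))
  have h' := ((Complex.continuous_re.tendsto _).comp h).const_add 1
  refine (h'.congr fun n => ?_).trans_eq ?_
  · simp only [oneAddPoleSum, cosZeroSq, Function.comp_apply, mul_pow, Complex.I_sq]
    congr 1
    rw [← Complex.ofReal_re (∑ k ∈ range n, _)]
    push_cast
    simp
  · congr 1
    rw [Complex.tan_mul_I, ← Complex.ofReal_tanh,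
      show (y : ℂ) * Complex.I * (Real.tanh y * Complex.I) = ((-(y * Real.tanh y) : ℝ) : ℂ) by
        push_cast; linear_combination (y * Complex.tanh y : ℂ) * Complex.I_sq, Complex.ofReal_re]
    ring

open Polynomial in
/-- The numerator of `oneAddPoleSum A n` over the denominator `∏ k < n, (1 - t / A k)`. -/
noncomputable def poleSumNumer (A : ℕ → ℝ) (n : ℕ) : ℝ[X] :=
  ∏ k ∈ range n, (1 - C (A k)⁻¹ * X) +
    ∑ j ∈ range n, C (2 / A j) * X * ∏ k ∈ (range n).erase j, (1 - C (A k)⁻¹ * X)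

lemma Polynomial.natDegree_prod_one_sub_C_mul_X_le (s : Finset ℕ) (a : ℕ → ℝ) :
    (∏ k ∈ s, (1 - C (a k) * X)).natDegree ≤ #s := by
  refine (natDegree_prod_le _ _).trans ?_
  refine (sum_le_card_nsmul s _ 1 fun k _ => ?_).trans_eq (by simp)
  compute_degree

lemma natDegree_poleSumNumer_le (A : ℕ → ℝ) (n : ℕ) : (poleSumNumer A n).natDegree ≤ n := by
  refine Polynomial.natDegree_add_le_of_degree_le ?_ ?_
  · simpa using Polynomial.natDegree_prod_one_sub_C_mul_X_le (range n) fun k => (A k)⁻¹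
  · refine Polynomial.natDegree_sum_le_of_forall_le _ _ fun j hj => ?_
    have hn : 0 < n := (Nat.zero_le j).trans_lt (mem_range.1 hj)
    have h := Polynomial.natDegree_prod_one_sub_C_mul_X_le ((range n).erase j) fun k => (A k)⁻¹
    rw [card_erase_of_mem hj, card_range] at h
    refine (Polynomial.natDegree_mul_le_of_le (m := 1) (by compute_degree) h).trans ?_
    omega

lemma eval_poleSumNumer (A : ℕ → ℝ) (n : ℕ) (t : ℝ) :
    (poleSumNumer A n).eval t = ∏ k ∈ range n, (1 - t / A k) +
      ∑ j ∈ range n, 2 * t / A j * ∏ k ∈ (range n).erase j, (1 - t / A k) := by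
  simp only [poleSumNumer, Polynomial.eval_add, Polynomial.eval_prod, Polynomial.eval_finsetSum,
    Polynomial.eval_mul, Polynomial.eval_sub, Polynomial.eval_one, Polynomial.eval_C,
    Polynomial.eval_X, div_eq_mul_inv]
  congr 1
  · exact prod_congr rfl fun k _ => by ring
  · refine sum_congr rfl fun j _ => ?_
    simp only [mul_comm t]
    ring

lemma eval_poleSumNumer_of_forall_ne {A : ℕ → ℝ} (hA : ∀ k, A k ≠ 0) {n : ℕ} {t : ℝ}
    (ht : ∀ k, t ≠ A k) : (poleSumNumer A n).eval t =
      (∏ k ∈ range n, (1 - t / A k)) * oneAddPoleSum A n t := by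
  rw [eval_poleSumNumer, oneAddPoleSum, mul_add, mul_one, mul_sum]
  congr 1
  refine sum_congr rfl fun j hj => ?_
  rw [← mul_prod_erase _ _ hj]
  have h1 := hA j
  have h2 : A j - t ≠ 0 := sub_ne_zero.2 (ht j).symm
  field_simp

lemma eval_poleSumNumer_self {A : ℕ → ℝ} (hA : ∀ k, A k ≠ 0) {m n : ℕ} (hm : m < n) :
    (poleSumNumer A n).eval (A m) = 2 * ∏ k ∈ (range n).erase m, (1 - A m / A k) := by
  have hm' := mem_range.2 hm
  have h0 : 1 - A m / A m = 0 := by rw [div_self (hA m), sub_self]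
  rw [eval_poleSumNumer, prod_eq_zero hm' h0, zero_add, sum_eq_single_of_mem m hm']
  · rw [mul_div_assoc, div_self (hA m), mul_one]
  · intro j _ hj
    rw [prod_eq_zero (mem_erase.2 ⟨hj.symm, hm'⟩) h0, mul_zero]

lemma prod_one_sub_div_ne_zero {A : ℕ → ℝ} (hA : ∀ k, A k ≠ 0) {t : ℝ} (ht : ∀ k, t ≠ A k)
    (n : ℕ) : ∏ k ∈ range n, (1 - t / A k) ≠ 0 := by
  refine prod_ne_zero_iff.2 fun k _ => ?_
  rw [sub_ne_zero, ne_comm, Ne, div_eq_one_iff_eq (hA k)]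
  exact ht k

/-- If the `s k` are the zeros of `oneAddPoleSum A n`, then its numerator factors over them. -/
lemma prod_mul_oneAddPoleSum_eq_prod {A : ℕ → ℝ} (hA : ∀ k, A k ≠ 0) {n : ℕ} {s : ℕ → ℝ}
    (hinj : Set.InjOn s (range n)) (hs0 : ∀ k < n, s k ≠ 0) (hsA : ∀ k < n, ∀ j, s k ≠ A j)
    (hs : ∀ k < n, oneAddPoleSum A n (s k) = 0) {t : ℝ} (ht : ∀ k, t ≠ A k) :
    (∏ k ∈ range n, (1 - t / A k)) * oneAddPoleSum A n t = ∏ k ∈ range n, (1 - t / s k) := by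
  have key : poleSumNumer A n =
      ∏ k ∈ range n, (1 - Polynomial.C (s k)⁻¹ * Polynomial.X) := by
    refine Polynomial.eq_of_natDegree_lt_card_of_eval_eq' _ _ (insert 0 ((range n).image s)) ?_ ?_
    · intro x hx
      rcases mem_insert.1 hx with rfl | hx
      · rw [eval_poleSumNumer]
        simp [Polynomial.eval_prod]
      · obtain ⟨k, hk, rfl⟩ := mem_image.1 hx
        have hk' := mem_range.1 hk
        rw [eval_poleSumNumer_of_forall_ne hA (hsA k hk'), hs k hk', mul_zero,
          Polynomial.eval_prod, prod_eq_zero hk]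
        simp [hs0 k hk']
    · have h0 : (0 : ℝ) ∉ (range n).image s := by
        intro h
        obtain ⟨k, hk, h⟩ := mem_image.1 h
        exact hs0 k (mem_range.1 hk) h
      rw [card_insert_of_notMem h0, card_image_of_injOn hinj, card_range, Nat.lt_succ_iff]
      refine max_le (natDegree_poleSumNumer_le A n) ?_
      simpa using Polynomial.natDegree_prod_one_sub_C_mul_X_le (range n) fun k => (s k)⁻¹
  rw [← eval_poleSumNumer_of_forall_ne hA ht, key, Polynomial.eval_prod]
  exact prod_congr rfl fun k _ => by simp [div_eq_inv_mul]

lemma exists_mem_Ioo_eq_zero_of_mul_neg {f : ℝ → ℝ} {a b : ℝ} (hab : a < b)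
    (hf : ContinuousOn f (Set.Icc a b)) (h : f a * f b < 0) : ∃ c ∈ Set.Ioo a b, f c = 0 := by
  rcases mul_neg_iff.1 h with ⟨ha, hb⟩ | ⟨ha, hb⟩
  · exact intermediate_value_Ioo' hab.le hf ⟨hb, ha⟩
  · exact intermediate_value_Ioo hab.le hf ⟨ha, hb⟩

lemma StrictMono.ne_of_mem_Ioo {A : ℕ → ℝ} (hA : StrictMono A) {m : ℕ} {t : ℝ}
    (ht : t ∈ Set.Ioo (A m) (A (m + 1))) (k : ℕ) : t ≠ A k := by
  rintro rfl
  have h1 := hA.lt_iff_lt.1 ht.1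
  have h2 := hA.lt_iff_lt.1 ht.2
  omega

lemma StrictMono.sub_mul_sub_pos {A : ℕ → ℝ} (hA : StrictMono A) {m : ℕ} {s t : ℝ}
    (hs : s ∈ Set.Ioo (A m) (A (m + 1))) (ht : t ∈ Set.Ioo (A m) (A (m + 1))) (k : ℕ) :
    0 < (A k - t) * (A k - s) := by
  rcases Nat.lt_or_ge m k with h | h
  · have := hA.monotone (Nat.succ_le_of_lt h)
    exact mul_pos (by linarith [ht.2]) (by linarith [hs.2])
  · have := hA.monotone h
    exact mul_pos_of_neg_of_neg (by linarith [ht.1]) (by linarith [hs.1])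

lemma exists_oneAddPoleSum_eq_zero {A : ℕ → ℝ} (hA : StrictMono A) (hpos : ∀ k, 0 < A k)
    {m n : ℕ} (hmn : m + 1 < n) :
    ∃ s ∈ Set.Ioo (A m) (A (m + 1)), oneAddPoleSum A n s = 0 := by
  have hne k := (hpos k).ne'
  have hlt := hA m.lt_succ_self
  obtain ⟨s, hs, h⟩ := exists_mem_Ioo_eq_zero_of_mul_neg (f := (poleSumNumer A n).eval) hlt
    (poleSumNumer A n).continuous.continuousOn (by
      rw [eval_poleSumNumer_self hne (by omega), eval_poleSumNumer_self hne hmn,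
        ← mul_prod_erase ((range n).erase m) _ (a := m + 1) (by simp; omega),
        ← mul_prod_erase ((range n).erase (m + 1)) _ (a := m) (by simp; omega),
        erase_right_comm]
      have h1 : 0 < 1 - A m / A (m + 1) := by
        rw [sub_pos, div_lt_one (hpos _)]; exact hlt
      have h2 : 1 - A (m + 1) / A m < 0 := by
        rw [sub_neg, one_lt_div (hpos _)]; exact hlt
      have h3 : 0 < ∏ k ∈ ((range n).erase (m + 1)).erase m,
          ((1 - A m / A k) * (1 - A (m + 1) / A k)) := by
        refine prod_pos fun k hk => ?_
        simp only [mem_erase] at hk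
        have e : (1 - A m / A k) * (1 - A (m + 1) / A k) =
            (A k - A m) * (A k - A (m + 1)) / A k ^ 2 := by
          have := hne k
          field_simp
        rw [e]
        refine div_pos ?_ (pow_pos (hpos k) 2)
        rcases Nat.lt_or_ge k m with h | h
        · have h5 := hA h
          exact mul_pos_of_neg_of_neg (by linarith) (by linarith)
        · have h5 := hA (show m + 1 < k by omega)
          exact mul_pos (by linarith) (by linarith)
      rw [prod_mul_distrib] at h3
      have h4 := mul_neg_of_pos_of_neg (mul_pos h1 h3) h2
      linarith)
  refine ⟨s, hs, ?_⟩
  have hs' := hA.ne_of_mem_Ioo hs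
  change (poleSumNumer A n).eval s = 0 at h
  rw [eval_poleSumNumer_of_forall_ne hne hs'] at h
  exact (mul_eq_zero.1 h).resolve_left (prod_one_sub_div_ne_zero hne hs' n)

lemma exists_neg_oneAddPoleSum_eq_zero {A : ℕ → ℝ} (hpos : ∀ k, 0 < A k) {n : ℕ} (hn : 0 < n) :
    ∃ s < 0, oneAddPoleSum A n s = 0 := by
  have h0 := hpos 0
  obtain ⟨s, hs, h⟩ := exists_mem_Ioo_eq_zero_of_mul_neg (f := oneAddPoleSum A n)
    (a := -2 * A 0) (b := 0) (by linarith) (by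
      refine continuousOn_const.add (continuousOn_finsetSum _ fun k _ => ?_)
      refine ContinuousOn.div (by fun_prop) (by fun_prop) fun t ht => ?_
      linarith [ht.2, hpos k]) (by
      have h1 : oneAddPoleSum A n 0 = 1 := by simp [oneAddPoleSum]
      rw [h1, mul_one, oneAddPoleSum]
      have h2 : ∑ k ∈ range n, 2 * (-2 * A 0) / (A k - -2 * A 0) ≤
          2 * (-2 * A 0) / (A 0 - -2 * A 0) := by
        rw [← add_sum_erase _ _ (mem_range.2 hn)]
        refine add_le_of_nonpos_right (sum_nonpos fun k _ => ?_)
        exact div_nonpos_of_nonpos_of_nonneg (by linarith) (by linarith [hpos k])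
      have h3 : 2 * (-2 * A 0) / (A 0 - -2 * A 0) = -4 / 3 := by
        field_simp
        norm_num
      linarith)
  exact ⟨s, hs.2, h⟩

/-- Zeros of `oneAddPoleSum A (n + 1)` lying between the same poles as `t` tend to `t`, provided `t` is
a zero of the limit. -/
lemma tendsto_of_oneAddPoleSum_eq_zero {A : ℕ → ℝ} (hpos : ∀ k, 0 < A k) {s : ℕ → ℝ} {t : ℝ}
    (hside : ∀ n k, 0 < (A k - t) * (A k - s n))
    (hs : ∀ᶠ n in atTop, oneAddPoleSum A (n + 1) (s n) = 0)
    (ht : Tendsto (fun n => oneAddPoleSum A n t) atTop (𝓝 0)) : Tendsto s atTop (𝓝 t) := by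
  have hne : ∀ n k, A k - t ≠ 0 ∧ A k - s n ≠ 0 := fun n k =>
    mul_ne_zero_iff.1 (hside n k).ne'
  have hA0 := (hpos 0).ne'
  have key : Tendsto (fun n => 2 * A 0 / (A 0 - s n)) atTop (𝓝 (2 * A 0 / (A 0 - t))) := by
    rw [tendsto_iff_norm_sub_tendsto_zero]
    refine squeeze_zero' (Eventually.of_forall fun n => norm_nonneg _) ?_
      (tendsto_zero_iff_norm_tendsto_zero.1 ((tendsto_add_atTop_iff_nat 1).2 ht))
    filter_upwards [hs] with n hn
    have term : ∀ k, 2 * t / (A k - t) - 2 * s n / (A k - s n) =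
        (t - s n) * (2 * A k / ((A k - t) * (A k - s n))) := by
      intro k
      obtain ⟨h1, h2⟩ := hne n k
      field_simp
      ring
    have hsum : oneAddPoleSum A (n + 1) t =
        (t - s n) * ∑ k ∈ range (n + 1), 2 * A k / ((A k - t) * (A k - s n)) := by
      rw [← sub_zero (oneAddPoleSum A (n + 1) t), ← hn, oneAddPoleSum, oneAddPoleSum,
        add_sub_add_left_eq_sub, ← sum_sub_distrib, mul_sum]
      exact sum_congr rfl fun k _ => term k
    have hnonneg : ∀ k, 0 ≤ 2 * A k / ((A k - t) * (A k - s n)) := fun k =>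
      div_nonneg (by linarith [hpos k]) (hside n k).le
    have e : 2 * A 0 / (A 0 - s n) - 2 * A 0 / (A 0 - t) =
        -((t - s n) * (2 * A 0 / ((A 0 - t) * (A 0 - s n)))) := by
      obtain ⟨h1, h2⟩ := hne n 0
      field_simp
      ring
    rw [hsum, e, norm_neg, norm_mul, norm_mul, Real.norm_of_nonneg (hnonneg 0),
      Real.norm_of_nonneg (sum_nonneg fun k _ => hnonneg k)]
    refine mul_le_mul_of_nonneg_left ?_ (norm_nonneg _)
    exact single_le_sum (fun k _ => hnonneg k) (mem_range.2 n.succ_pos)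
  have h := (tendsto_const_nhds (x := 2 * A 0)).div key
    (div_ne_zero (by simpa using hA0) (hne 0 0).1)
  have h' := (tendsto_const_nhds (x := A 0)).sub h
  refine (h'.congr fun n => ?_).trans_eq ?_
  · simp only [Pi.div_apply]
    rw [div_div_cancel₀ (by simpa using hA0), sub_sub_cancel]
  · rw [div_div_cancel₀ (by simpa using hA0), sub_sub_cancel]

lemma cosZeroSq_pos (k : ℕ) : 0 < cosZeroSq k := by
  have := Real.pi_pos
  unfold cosZeroSq
  positivity

lemma cos_half_add_mul_pi (k : ℕ) : Real.cos (((k : ℝ) + 1 / 2) * Real.pi) = 0 := by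
  rw [show ((k : ℝ) + 1 / 2) * Real.pi = k * Real.pi + Real.pi / 2 by ring,
    Real.cos_add_pi_div_two, Real.sin_nat_mul_pi, neg_zero]

lemma strictMono_half_add_mul_pi : StrictMono fun k : ℕ => ((k : ℝ) + 1 / 2) * Real.pi := by
  intro a b h
  have : (a : ℝ) < b := by exact_mod_cast h
  exact mul_lt_mul_of_pos_right (by linarith) Real.pi_pos

lemma strictMono_cosZeroSq : StrictMono cosZeroSq := fun a b h =>
  pow_lt_pow_left₀ (strictMono_half_add_mul_pi h) (by have := Real.pi_pos; positivity) two_ne_zero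

lemma summable_inv_cosZeroSq : Summable fun k => (cosZeroSq k)⁻¹ := by
  have h := (Real.summable_one_div_nat_add_rpow (1 / 2) 2).2 one_lt_two
  refine (h.mul_left (Real.pi ^ 2)⁻¹).congr fun k => ?_
  have hk : (0 : ℝ) < k + 1 / 2 := by positivity
  rw [cosZeroSq, mul_pow, abs_of_pos hk, Real.rpow_two, one_div, mul_inv, mul_comm]

lemma sin_two_mul_ne_zero_of_root {t : ℝ} (ht : Real.cos t + t * Real.sin t = 0) (h0 : t ≠ 0) :
    Real.sin (2 * t) ≠ 0 := by
  rw [Real.sin_two_mul]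
  intro h
  have h1 := Real.sin_sq_add_cos_sq t
  have hs : Real.sin t = 0 := by
    rcases mul_eq_zero.1 h with h | h
    · linarith
    · rw [h, zero_add] at ht
      exact (mul_eq_zero.1 ht).resolve_left h0
  rw [hs, mul_zero, add_zero] at ht
  simp [hs, ht] at h1

lemma tendsto_oneAddPoleSum_root {t : ℝ} (ht : Real.cos t + t * Real.sin t = 0) (h0 : t ≠ 0) :
    Tendsto (fun n => oneAddPoleSum cosZeroSq n (t ^ 2)) atTop (𝓝 0) := by
  have h := sin_two_mul_ne_zero_of_root ht h0
  refine (tendsto_oneAddPoleSum_sq h).trans_eq ?_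
  have hc : Real.cos t ≠ 0 := fun hc => h (by rw [Real.sin_two_mul, hc, mul_zero])
  rw [Real.tan_eq_sin_div_cos]
  congr 1
  field_simp
  linarith

lemma exists_root_mem_Ioo (m : ℕ) :
    ∃ t ∈ Set.Ioo (((m : ℝ) + 1 / 2) * Real.pi) (((m + 1 : ℕ) + 1 / 2 : ℝ) * Real.pi),
      Real.cos t + t * Real.sin t = 0 := by
  have hval : ∀ k : ℕ, Real.cos (((k : ℝ) + 1 / 2) * Real.pi) +
      ((k : ℝ) + 1 / 2) * Real.pi * Real.sin (((k : ℝ) + 1 / 2) * Real.pi) =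
        ((k : ℝ) + 1 / 2) * Real.pi * (-1) ^ k := by
    intro k
    have hs : Real.sin (((k : ℝ) + 1 / 2) * Real.pi) = (-1) ^ k := by
      rw [show ((k : ℝ) + 1 / 2) * Real.pi = k * Real.pi + Real.pi / 2 by ring,
        Real.sin_add_pi_div_two, Real.cos_nat_mul_pi]
    rw [cos_half_add_mul_pi, hs, zero_add]
  refine exists_mem_Ioo_eq_zero_of_mul_neg (f := fun t => Real.cos t + t * Real.sin t)
    (strictMono_half_add_mul_pi m.lt_succ_self) (by fun_prop) ?_
  have hpi := Real.pi_pos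
  have h1 : 0 < ((m : ℝ) + 1 / 2) * Real.pi := by positivity
  have h2 : 0 < ((m + 1 : ℕ) + 1 / 2 : ℝ) * Real.pi := by positivity
  have h3 : ((-1 : ℝ) ^ m) * (-1) ^ m = 1 := by rw [← mul_pow]; simp
  simp only [hval]
  rw [pow_succ]
  nlinarith [mul_pos h1 h2]

lemma sq_mem_Ioo_cosZeroSq {m : ℕ} {t : ℝ} (ht : t ∈
    Set.Ioo (((m : ℝ) + 1 / 2) * Real.pi) (((m + 1 : ℕ) + 1 / 2 : ℝ) * Real.pi)) :
    t ^ 2 ∈ Set.Ioo (cosZeroSq m) (cosZeroSq (m + 1)) := by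
  have h : 0 < ((m : ℝ) + 1 / 2) * Real.pi := by have := Real.pi_pos; positivity
  exact ⟨pow_lt_pow_left₀ ht.1 h.le two_ne_zero,
    pow_lt_pow_left₀ ht.2 (h.trans ht.1).le two_ne_zero⟩

lemma exists_mem_Ioo_of_root {t : ℝ} (ht : Real.cos t + t * Real.sin t = 0) (h0 : 0 < t) :
    ∃ m : ℕ, t ∈
      Set.Ioo (((m : ℝ) + 1 / 2) * Real.pi) (((m + 1 : ℕ) + 1 / 2 : ℝ) * Real.pi) := by
  have hpi := Real.pi_pos
  have hgt : Real.pi / 2 < t := by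
    by_contra! h
    have hs := Real.sin_pos_of_pos_of_lt_pi h0 (by linarith)
    have hc := Real.cos_nonneg_of_mem_Icc ⟨by linarith, h⟩
    nlinarith [mul_pos h0 hs]
  have hnn : 0 ≤ t / Real.pi - 1 / 2 := by
    rw [sub_nonneg, le_div_iff₀ hpi]; linarith
  have h1 := Nat.floor_le hnn
  have h2 := Nat.lt_floor_add_one (t / Real.pi - 1 / 2)
  set m := ⌊t / Real.pi - 1 / 2⌋₊
  have h3 : ((m : ℝ) + 1 / 2) * Real.pi ≤ t := by
    rw [← le_div_iff₀ hpi]; linarith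
  refine ⟨m, lt_of_le_of_ne h3 ?_, ?_⟩
  · intro h
    refine sin_two_mul_ne_zero_of_root ht h0.ne' ?_
    rw [← h, show 2 * (((m : ℝ) + 1 / 2) * Real.pi) = ((2 * m + 1 : ℕ) : ℝ) * Real.pi by
      push_cast; ring]
    exact Real.sin_nat_mul_pi _
  · rw [← div_lt_iff₀ hpi]; push_cast; linarith

lemma tendsto_of_oneAddPoleSum_cosZeroSq {s : ℕ → ℝ} {m : ℕ} {t : ℝ}
    (hs : ∀ n, s n ∈ Set.Ioo (cosZeroSq m) (cosZeroSq (m + 1)))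
    (hs0 : ∀ n, m < n → oneAddPoleSum cosZeroSq (n + 1) (s n) = 0)
    (ht : t ∈ Set.Ioo (((m : ℝ) + 1 / 2) * Real.pi) (((m + 1 : ℕ) + 1 / 2 : ℝ) * Real.pi))
    (ht0 : Real.cos t + t * Real.sin t = 0) : Tendsto s atTop (𝓝 (t ^ 2)) := by
  have h0 : t ≠ 0 := by
    have := Real.pi_pos
    exact (lt_trans (by positivity) ht.1).ne'
  refine tendsto_of_oneAddPoleSum_eq_zero cosZeroSq_pos
    (fun n => strictMono_cosZeroSq.sub_mul_sub_pos (hs n) (sq_mem_Ioo_cosZeroSq ht)) ?_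
    (tendsto_oneAddPoleSum_root ht0 h0)
  filter_upwards [eventually_gt_atTop m] with n hn using hs0 n hn

lemma summable_inv_sq {X : ℕ → ℝ} (h : ∀ m, cosZeroSq m ≤ X m ^ 2) :
    Summable fun m => (X m ^ 2)⁻¹ :=
  summable_inv_cosZeroSq.of_nonneg_of_le (fun m => by positivity)
    fun m => inv_anti₀ (cosZeroSq_pos m) (h m)

lemma continuous_tprod_one_sub_sq_div {X : ℕ → ℝ} (h : Summable fun m => (X m ^ 2)⁻¹) :
    Continuous fun y : ℝ => ∏' m, (1 - y ^ 2 / X m ^ 2) := by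
  simp only [sub_eq_add_neg]
  refine continuous_iff_continuousAt.2 fun y => ?_
  refine tendsto_tprod_one_add_of_dominated_convergence (h.mul_left ((|y| + 1) ^ 2))
    (fun k => Continuous.tendsto (by fun_prop) y) ?_
  filter_upwards [continuous_abs.continuousAt.eventually_lt_const (lt_add_one |y|)] with z hz k
  rw [norm_neg, norm_div, div_eq_mul_inv, Real.norm_of_nonneg (sq_nonneg z),
    Real.norm_of_nonneg (sq_nonneg (X k)), ← sq_abs z]
  gcongr

lemma dense_setOf_sin_two_mul_ne_zero : Dense {y : ℝ | Real.sin (2 * y) ≠ 0} := by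
  have h : (Set.range fun n : ℤ => (n : ℝ) * Real.pi / 2).Countable := Set.countable_range _
  refine (h.dense_compl ℝ).mono fun y (hy : y ∉ _) h0 => hy ?_
  obtain ⟨n, hn⟩ := Real.sin_eq_zero_iff.1 h0
  exact ⟨n, by simp only [hn]; ring⟩


lemma tendsto_prod_one_sub_div {s : ℕ → ℕ → ℝ} {L : ℕ → ℝ}
    (hs : ∀ n m, cosZeroSq m ≤ s n m) (hlim : ∀ m, Tendsto (s · m) atTop (𝓝 (L m)))
    (hL : ∀ m, L m ≠ 0) (t : ℝ) :
    Tendsto (fun n => ∏ m ∈ range n, (1 - t / s n m)) atTop (𝓝 (∏' m, (1 - t / L m))) := by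
  have h := tendsto_tprod_one_add_of_dominated_convergence (𝓕 := atTop)
    (f := fun n m => if m < n then -(t / s n m) else 0) (g := fun m => -(t / L m))
    (summable_inv_cosZeroSq.mul_left |t|) (fun m => ?_) (Eventually.of_forall fun n m => ?_)
  · simp only [← sub_eq_add_neg] at h
    refine h.congr fun n => ?_
    rw [tprod_eq_prod (s := range n)]
    · refine prod_congr rfl fun m hm => ?_
      rw [if_pos (mem_range.1 hm), sub_eq_add_neg]
    · intro m hm
      rw [if_neg (by simpa using hm), add_zero]
  · refine ((tendsto_const_nhds.div (hlim m) (hL m)).neg).congr' ?_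
    filter_upwards [eventually_gt_atTop m] with n hn
    rw [if_pos hn]
    rfl
  · have hA := cosZeroSq_pos m
    split_ifs
    · have hpos := hA.trans_le (hs n m)
      rw [norm_neg, norm_div, div_eq_mul_inv, Real.norm_of_nonneg hpos.le, Real.norm_eq_abs]
      exact mul_le_mul_of_nonneg_left (inv_anti₀ hA (hs n m)) (abs_nonneg t)
    · rw [norm_zero]
      positivity

/-- Infinite product factorization of `cos x + x sin x`:
`cos x + x sin x = (1 + x²/α²) ∏_{m≥1} (1 - x²/x_m²)`, where `α` is the unique
positive solution of `cosh α = α sinh α` and `x 0 < x 1 < ⋯` enumerates the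
positive roots of `cos t + t sin t = 0` (so `x m` is the classical `x_{m+1}`). -/
theorem product_formula_cos_add_mul_sin
    (α : ℝ) (hα_pos : 0 < α) (hα_eq : Real.cosh α = α * Real.sinh α)
    (X : ℕ → ℝ) (hX_mono : StrictMono X) (hX_pos : ∀ m, 0 < X m)
    (hX_root : ∀ m, Real.cos (X m) + X m * Real.sin (X m) = 0)
    (hX_all : ∀ t : ℝ, 0 < t → Real.cos t + t * Real.sin t = 0 → ∃ m, X m = t)
    (x : ℝ) :
    Multipliable (fun m : ℕ => 1 - x ^ 2 / (X m) ^ 2) ∧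
    (1 + x ^ 2 / α ^ 2) * ∏' m : ℕ, (1 - x ^ 2 / (X m) ^ 2) =
      Real.cos x + x * Real.sin x := by
  choose ρ hρ hρ0 using exists_root_mem_Ioo
  have hA0 := cosZeroSq_pos 0
  have hne k := (cosZeroSq_pos k).ne'
  have hα2 : 0 < α ^ 2 := pow_pos hα_pos 2
  have hzero : ∀ n m, ∃ s ∈ Set.Ioo (cosZeroSq m) (cosZeroSq (m + 1)),
      m < n → oneAddPoleSum cosZeroSq (n + 1) s = 0 := by
    intro n m
    by_cases h : m < n
    · obtain ⟨s, hs, hs0⟩ := exists_oneAddPoleSum_eq_zero strictMono_cosZeroSq cosZeroSq_pos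
        (Nat.succ_lt_succ h)
      exact ⟨s, hs, fun _ => hs0⟩
    · obtain ⟨s, hs⟩ := exists_between (strictMono_cosZeroSq m.lt_succ_self)
      exact ⟨s, hs, fun h' => absurd h' h⟩
  choose s hs hs0 using hzero
  choose r hr hr0 using fun n : ℕ => exists_neg_oneAddPoleSum_eq_zero cosZeroSq_pos n.succ_pos
  have hs_lim : ∀ {m : ℕ} {t : ℝ}, t ∈ Set.Ioo (((m : ℝ) + 1 / 2) * Real.pi)
      (((m + 1 : ℕ) + 1 / 2 : ℝ) * Real.pi) → Real.cos t + t * Real.sin t = 0 →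
      Tendsto (s · m) atTop (𝓝 (t ^ 2)) := fun {m t} ht ht0 =>
    tendsto_of_oneAddPoleSum_cosZeroSq (fun n => hs n m) (fun n => hs0 n m) ht ht0
  have hr_lim : Tendsto r atTop (𝓝 (-α ^ 2)) := by
    refine tendsto_of_oneAddPoleSum_eq_zero cosZeroSq_pos (fun n k => mul_pos ?_ ?_)
      (Eventually.of_forall hr0) ((tendsto_oneAddPoleSum_neg_sq hα_pos.ne').trans_eq ?_)
    · linarith [cosZeroSq_pos k]
    · linarith [cosZeroSq_pos k, hr n]
    · rw [Real.tanh_eq_sinh_div_cosh, mul_div_assoc', ← hα_eq, div_self (Real.cosh_pos α).ne',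
        sub_self]
  have hρ_pos : ∀ m, 0 < ρ m := fun m =>
    lt_trans (by have := Real.pi_pos; positivity) (hρ m).1
  obtain rfl : X = ρ := by
    have hρ_mono : StrictMono ρ :=
      strictMono_nat_of_lt_succ fun m => (hρ m).2.trans (hρ (m + 1)).1
    refine (hX_mono.range_inj hρ_mono).1 (Set.ext fun t => ⟨?_, ?_⟩)
    · rintro ⟨m, rfl⟩
      obtain ⟨k, hk⟩ := exists_mem_Ioo_of_root (hX_root m) (hX_pos m)
      refine ⟨k, ?_⟩
      exact (pow_left_inj₀ (hρ_pos k).le (hX_pos m).le two_ne_zero).1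
        (tendsto_nhds_unique (hs_lim (hρ k) (hρ0 k)) (hs_lim hk (hX_root m)))
    · rintro ⟨m, rfl⟩
      exact hX_all _ (hρ_pos m) (hρ0 m)
  have hsum := summable_inv_sq fun m => (sq_mem_Ioo_cosZeroSq (hρ m)).1.le
  refine ⟨?_, ?_⟩
  · simp only [sub_eq_add_neg, div_eq_mul_inv]
    exact Real.multipliable_one_add_of_summable (hsum.mul_left (x ^ 2)).neg
  refine congr_fun (Continuous.ext_on dense_setOf_sin_two_mul_ne_zero
    (f := fun y => (1 + y ^ 2 / α ^ 2) * ∏' m, (1 - y ^ 2 / X m ^ 2))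
    (g := fun y => Real.cos y + y * Real.sin y)
    (Continuous.mul (by fun_prop) (continuous_tprod_one_sub_sq_div hsum)) (by fun_prop)
    fun y hy => ?_) x
  have hy' : Real.sin y ≠ 0 ∧ Real.cos y ≠ 0 := by
    rw [Set.mem_ofPred_eq, Real.sin_two_mul] at hy
    exact ⟨right_ne_zero_of_mul (left_ne_zero_of_mul hy), right_ne_zero_of_mul hy⟩
  have hyA : ∀ k, y ^ 2 ≠ cosZeroSq k := by
    intro k hk
    rcases sq_eq_sq_iff_eq_or_eq_neg.1 hk with h | h
    · exact hy'.2 (by rw [h, cos_half_add_mul_pi])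
    · exact hy'.2 (by rw [h, Real.cos_neg, cos_half_add_mul_pi])
  have hfac : ∀ n, (∏ k ∈ range (n + 1), (1 - y ^ 2 / cosZeroSq k)) *
      oneAddPoleSum cosZeroSq (n + 1) (y ^ 2) =
        (∏ m ∈ range n, (1 - y ^ 2 / s n m)) * (1 - y ^ 2 / r n) := by
    intro n
    let σ : ℕ → ℝ := fun k => Nat.casesOn k (r n) (s n)
    have hσ : StrictMono σ := strictMono_nat_of_lt_succ fun k => by
      cases k with
      | zero => exact (hr n).trans (hA0.trans (hs n 0).1)
      | succ k => exact (hs n k).2.trans (hs n (k + 1)).1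
    rw [prod_mul_oneAddPoleSum_eq_prod hne (s := σ) hσ.injective.injOn ?_ ?_ ?_ hyA,
      prod_range_succ']
    · rfl
    · intro k _
      cases k with
      | zero => exact (hr n).ne
      | succ k => exact ((cosZeroSq_pos k).trans (hs n k).1).ne'
    · intro k _ j
      cases k with
      | zero => exact ((hr n).trans (cosZeroSq_pos j)).ne
      | succ k => exact strictMono_cosZeroSq.ne_of_mem_Ioo (hs n k) j
    · intro k hk
      cases k with
      | zero => exact hr0 n
      | succ k => exact hs0 n k (by omega)
  have hlhs := ((tendsto_prod_cos hy'.1).mul (tendsto_oneAddPoleSum_sq hy)).comp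
    (tendsto_add_atTop_nat 1)
  have hrhs := (tendsto_prod_one_sub_div (fun n m => (hs n m).1.le)
    (fun m => hs_lim (hρ m) (hρ0 m)) (fun m => (pow_pos (hρ_pos m) 2).ne') (y ^ 2)).mul
    ((tendsto_const_nhds (x := y ^ 2)).div hr_lim (neg_ne_zero.2 hα2.ne') |>.const_sub 1)
  have h := tendsto_nhds_unique (hlhs.congr hfac) hrhs
  rw [Real.tan_eq_sin_div_cos] at h
  have e : Real.cos y * (1 + y * (Real.sin y / Real.cos y)) =
      Real.cos y + y * Real.sin y := by
    have := hy'.2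
    field_simp
  rw [e, div_neg, sub_neg_eq_add] at h
  exact (mul_comm _ _).trans h.symm
end

section
/- Let α be the unique positive real number satisfying cosh α = α · sinh α, and let (x_m)_{m≥1} be the strictly increasing enumeration of the positive solutions of cos x + x·sin x = 0. Then the series Σ_{m=1}^∞ 1/x_m² converges and Σ_{m=1}^∞ 1/x_m² = 1/α² − 1/2. -/
open Polynomial Filter Topology Set

/-- The pair of polynomials `(A, B)` in `w` with
`(1 + s i z) ^ k = A (z ^ 2) + i z B (z ^ 2)`. -/
noncomputable def evenOddParts (s : ℝ) : ℕ → ℝ[X] × ℝ[X]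
  | 0 => (1, 0)
  | k + 1 => ((evenOddParts s k).1 - C s * (X * (evenOddParts s k).2),
      (evenOddParts s k).2 + C s * (evenOddParts s k).1)

/-- The polynomial in `w = z ^ 2` approximating `cos z + z sin z`, namely the real part of
`(1 - i z) (1 + s i z) ^ k` for real `z`; the approximation is good for `s = 1 / k`, `k` large. -/
noncomputable def secularPoly (s : ℝ) (k : ℕ) : ℝ[X] :=
  (evenOddParts s k).1 + X * (evenOddParts s k).2

theorem natDegree_evenOddParts (s : ℝ) (k : ℕ) :
    (evenOddParts s k).1.natDegree ≤ k / 2 ∧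
      (X * (evenOddParts s k).2).natDegree ≤ (k + 1) / 2 := by
  induction k with
  | zero => simp [evenOddParts]
  | succ k ih =>
    obtain ⟨hA, hB⟩ := ih
    have hXA : (X * (evenOddParts s k).1).natDegree ≤ (k + 1 + 1) / 2 :=
      natDegree_mul_le.trans (by rw [natDegree_X]; omega)
    simp only [evenOddParts]
    refine ⟨(natDegree_sub_le_of_le hA ((natDegree_C_mul_le _ _).trans hB)).trans (by omega), ?_⟩
    rw [mul_add, mul_left_comm]
    exact natDegree_add_le_of_degree_le (hB.trans (by omega)) ((natDegree_C_mul_le _ _).trans hXA)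

theorem natDegree_secularPoly (s : ℝ) (k : ℕ) : (secularPoly s k).natDegree ≤ (k + 1) / 2 :=
  natDegree_add_le_of_degree_le ((natDegree_evenOddParts s k).1.trans (by omega))
    (natDegree_evenOddParts s k).2

theorem eval_zero_evenOddParts (s : ℝ) (k : ℕ) :
    (evenOddParts s k).1.eval 0 = 1 ∧ (evenOddParts s k).2.eval 0 = k * s ∧
      (derivative (evenOddParts s k).1).eval 0 = -(k * (k - 1) / 2) * s ^ 2 := by
  induction k with
  | zero => simp [evenOddParts]
  | succ k ih =>
    obtain ⟨hA, hB, hA'⟩ := ih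
    refine ⟨?_, ?_, ?_⟩
    · simp [evenOddParts, hA]
    · simp [evenOddParts, hA, hB]; ring
    · simp [evenOddParts, hA', hB]; ring

theorem eval_zero_secularPoly (s : ℝ) (k : ℕ) : (secularPoly s k).eval 0 = 1 := by
  simp [secularPoly, eval_zero_evenOddParts]

theorem eval_zero_derivative_secularPoly (s : ℝ) (k : ℕ) :
    (derivative (secularPoly s k)).eval 0 = k * s - k * (k - 1) / 2 * s ^ 2 := by
  simp [secularPoly, eval_zero_evenOddParts]; ring

theorem eval_sq_evenOddParts {s z φ : ℝ} (h : s * z * Real.cos φ = Real.sin φ) (k : ℕ) :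
    (evenOddParts s k).1.eval (z ^ 2) * Real.cos φ ^ k = Real.cos (k * φ) ∧
      z * (evenOddParts s k).2.eval (z ^ 2) * Real.cos φ ^ k = Real.sin (k * φ) := by
  induction k with
  | zero => simp [evenOddParts]
  | succ k ih =>
    obtain ⟨hA, hB⟩ := ih
    have hk : ((k + 1 : ℕ) : ℝ) * φ = k * φ + φ := by push_cast; ring
    rw [hk, Real.cos_add, Real.sin_add, ← hA, ← hB, ← h]
    constructor <;> simp [evenOddParts] <;> ring

theorem eval_sq_secularPoly {s z φ : ℝ} (h : s * z * Real.cos φ = Real.sin φ) (k : ℕ) :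
    (secularPoly s k).eval (z ^ 2) * Real.cos φ ^ k =
      Real.cos (k * φ) + z * Real.sin (k * φ) := by
  obtain ⟨hA, hB⟩ := eval_sq_evenOddParts h k
  rw [← hA, ← hB]
  simp [secularPoly]; ring

theorem eval_neg_sq_evenOddParts (s a : ℝ) (k : ℕ) :
    (evenOddParts s k).1.eval (-a ^ 2) + a * (evenOddParts s k).2.eval (-a ^ 2) =
        (1 + s * a) ^ k ∧
      (evenOddParts s k).1.eval (-a ^ 2) - a * (evenOddParts s k).2.eval (-a ^ 2) =
        (1 - s * a) ^ k := by
  induction k with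
  | zero => simp [evenOddParts]
  | succ k ih =>
    obtain ⟨h₁, h₂⟩ := ih
    rw [pow_succ (1 + s * a), pow_succ (1 - s * a), ← h₁, ← h₂]
    constructor <;> simp [evenOddParts] <;> ring

theorem eval_neg_sq_secularPoly (s a : ℝ) (k : ℕ) :
    (secularPoly s k).eval (-a ^ 2) =
      ((1 + a) * (1 - s * a) ^ k + (1 - a) * (1 + s * a) ^ k) / 2 := by
  obtain ⟨h₁, h₂⟩ := eval_neg_sq_evenOddParts s a k
  rw [← h₁, ← h₂]
  simp [secularPoly]; ring

theorem Polynomial.sum_inv_of_natDegree_le_card {p : ℝ[X]} {S : Finset ℝ} (h0 : p.eval 0 ≠ 0)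
    (hS : ∀ x ∈ S, p.eval x = 0) (hd : p.natDegree ≤ S.card) :
    ∑ x ∈ S, 1 / x = -((derivative p).eval 0 / p.eval 0) := by
  have hp : p ≠ 0 := by rintro rfl; simp at h0
  have hle : S.val ≤ p.roots :=
    (Multiset.le_iff_subset S.nodup).2 fun x hx => (mem_roots hp).2 (hS x hx)
  have hroots : S.val = p.roots := Multiset.eq_of_le_of_card_le hle ((card_roots' p).trans hd)
  have hsplit : p.Splits :=
    splits_iff_card_roots.2 (le_antisymm (card_roots' p) (hroots ▸ hd))
  rw [hsplit.eval_derivative_div_eval_of_ne_zero h0, ← hroots, Finset.sum_map_val,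
    ← Finset.sum_neg_distrib]
  refine Finset.sum_congr rfl fun x _ => ?_
  rw [zero_sub, div_neg, neg_neg]

theorem sum_inv_sq_of_secularPoly_roots {M : ℕ} {a : ℝ} {z : ℕ → ℝ} (ha : 0 < a)
    (hz : ∀ m < M, 0 < z m) (hmono : StrictMonoOn z (Iio M))
    (hza : (secularPoly (1 / (2 * M + 1 : ℕ)) (2 * M + 1)).eval (-a ^ 2) = 0)
    (hzm : ∀ m < M, (secularPoly (1 / (2 * M + 1 : ℕ)) (2 * M + 1)).eval (z m ^ 2) = 0) :
    ∑ m ∈ Finset.range M, 1 / z m ^ 2 = 1 / a ^ 2 - 1 / 2 - 1 / (2 * (2 * M + 1)) := by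
  have hinj : InjOn (fun m => z m ^ 2) (Finset.range M) := by
    intro i hi j hj hij
    rw [Finset.coe_range] at hi hj
    exact hmono.injOn hi hj ((pow_left_inj₀ (hz i hi).le (hz j hj).le two_ne_zero).1 hij)
  have hnot : -a ^ 2 ∉ (Finset.range M).image (fun m => z m ^ 2) := by
    rw [Finset.mem_image]
    rintro ⟨m, -, hm⟩
    have := pow_pos ha 2
    nlinarith [sq_nonneg (z m)]
  have key := sum_inv_of_natDegree_le_card
    (S := insert (-a ^ 2) ((Finset.range M).image fun m => z m ^ 2))
    (p := secularPoly (1 / (2 * M + 1 : ℕ)) (2 * M + 1))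
    (by rw [eval_zero_secularPoly]; exact one_ne_zero)
    (by
      intro x hx
      rcases Finset.mem_insert.1 hx with rfl | hx
      · exact hza
      · obtain ⟨m, hm, rfl⟩ := Finset.mem_image.1 hx
        exact hzm m (Finset.mem_range.1 hm))
    (by
      rw [Finset.card_insert_of_notMem hnot, Finset.card_image_of_injOn hinj, Finset.card_range]
      exact (natDegree_secularPoly _ _).trans (by omega))
  rw [Finset.sum_insert hnot, Finset.sum_image hinj, eval_zero_secularPoly,
    eval_zero_derivative_secularPoly] at key
  have hM : (2 * (M : ℝ) + 1) ≠ 0 := by positivity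
  have hcoef : (((2 * M + 1 : ℕ) : ℝ) * (1 / (2 * M + 1 : ℕ)) -
      ((2 * M + 1 : ℕ) : ℝ) * ((2 * M + 1 : ℕ) - 1) / 2 * (1 / (2 * M + 1 : ℕ)) ^ 2) / 1 =
      1 / 2 + 1 / (2 * (2 * M + 1)) := by
    push_cast
    field_simp
    ring
  rw [hcoef, div_neg] at key
  linarith

theorem add_one_le_nat_mul_pi_add (m : ℕ) {r : ℝ} (hr : Real.pi / 2 ≤ r) :
    (m : ℝ) + 1 ≤ m * Real.pi + r := by
  have hπ := Real.pi_gt_three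
  have : (m : ℝ) * 1 ≤ m * Real.pi := by gcongr; linarith
  linarith

theorem nat_mul_pi_add_pos (m : ℕ) {r : ℝ} (hr : Real.pi / 2 ≤ r) : 0 < m * Real.pi + r :=
  lt_of_lt_of_le (by positivity) (add_one_le_nat_mul_pi_add m hr)

theorem exists_tan_secular_root {n m : ℕ} (h : 2 * (m + 1) < n) :
    ∃ r ∈ Icc (Real.pi / 2) Real.pi,
      Real.cos r + n * Real.tan ((m * Real.pi + r) / n) * Real.sin r = 0 := by
  have hπ := Real.pi_pos
  have hn : (0 : ℝ) < n := by exact_mod_cast (by omega : 0 < n)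
  have hlt : 2 * ((m : ℝ) + 1) < n := by exact_mod_cast h
  have hφ : ∀ r ∈ Icc (Real.pi / 2) Real.pi,
      0 < (m * Real.pi + r) / n ∧ (m * Real.pi + r) / n < Real.pi / 2 := by
    rintro r ⟨hr₁, hr₂⟩
    refine ⟨div_pos (nat_mul_pi_add_pos m hr₁) hn, ?_⟩
    rw [div_lt_iff₀ hn]
    nlinarith
  have hcont : ContinuousOn
      (fun r => Real.cos r + n * Real.tan ((m * Real.pi + r) / n) * Real.sin r)
      (Icc (Real.pi / 2) Real.pi) := by
    refine Real.continuous_cos.continuousOn.add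
      ((continuousOn_const.mul ?_).mul Real.continuous_sin.continuousOn)
    refine Real.continuousOn_tan_Ioo.comp (by fun_prop) fun r hr => ?_
    exact ⟨by linarith [(hφ r hr).1], (hφ r hr).2⟩
  obtain ⟨r, hr, hr0⟩ := intermediate_value_Icc' (by linarith) hcont
    (show (0 : ℝ) ∈ Icc _ _ by
      have h₁ := hφ (Real.pi / 2) ⟨le_rfl, by linarith⟩
      have := Real.tan_pos_of_pos_of_lt_pi_div_two h₁.1 h₁.2
      constructor
      · simp
      · simp; positivity)
  exact ⟨r, hr, hr0⟩

theorem strictAntiOn_cos_add_mul_sin (m : ℕ) :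
    StrictAntiOn (fun r => Real.cos r + (m * Real.pi + r) * Real.sin r)
      (Icc (Real.pi / 2) Real.pi) := by
  have hπ := Real.pi_pos
  refine strictAntiOn_of_deriv_neg (convex_Icc _ _) (by fun_prop) fun r hr => ?_
  rw [interior_Icc] at hr
  have hd : HasDerivAt (fun r => Real.cos r + (m * Real.pi + r) * Real.sin r)
      (-Real.sin r + (1 * Real.sin r + (m * Real.pi + r) * Real.cos r)) r :=
    (Real.hasDerivAt_cos r).add
      (((hasDerivAt_id r).const_add (m * Real.pi)).mul (Real.hasDerivAt_sin r))
  rw [hd.deriv]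
  have hc : Real.cos r < 0 := Real.cos_neg_of_pi_div_two_lt_of_lt hr.1 (by linarith [hr.2])
  have := nat_mul_pi_add_pos m hr.1.le
  nlinarith [mul_neg_of_pos_of_neg this hc]

theorem exists_cos_add_mul_sin_eq_zero (m : ℕ) :
    ∃ r ∈ Icc (Real.pi / 2) Real.pi,
      Real.cos r + (m * Real.pi + r) * Real.sin r = 0 := by
  have hπ := Real.pi_pos
  obtain ⟨r, hr, hr0⟩ := intermediate_value_Icc' (by linarith : Real.pi / 2 ≤ Real.pi)
    (f := fun r => Real.cos r + (m * Real.pi + r) * Real.sin r) (by fun_prop)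
    (show (0 : ℝ) ∈ Icc _ _ by
      constructor
      · simp
      · simp; positivity)
  exact ⟨r, hr, hr0⟩

theorem cos_add_mul_sin_add_nat_mul_pi (m : ℕ) (c r : ℝ) :
    Real.cos (m * Real.pi + r) + c * Real.sin (m * Real.pi + r) =
      (-1) ^ m * (Real.cos r + c * Real.sin r) := by
  rw [add_comm (m * Real.pi), Real.cos_add_nat_mul_pi, Real.sin_add_nat_mul_pi]
  ring

theorem strictMono_nat_mul_pi_add {r : ℕ → ℝ} (hr : ∀ m, r m ∈ Icc (Real.pi / 2) Real.pi) :
    StrictMono fun m : ℕ => m * Real.pi + r m := by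
  refine strictMono_nat_of_lt_succ fun m => ?_
  have h₁ := (hr m).2
  have h₂ := (hr (m + 1)).1
  have := Real.pi_pos
  push_cast
  linarith

theorem eq_of_secular_enumeration {X r : ℕ → ℝ} (hX_mono : StrictMono X) (hX_pos : ∀ m, 0 < X m)
    (hX_root : ∀ m, Real.cos (X m) + X m * Real.sin (X m) = 0)
    (hX_all : ∀ t : ℝ, 0 < t → Real.cos t + t * Real.sin t = 0 → ∃ m, X m = t)
    (hr : ∀ m, r m ∈ Icc (Real.pi / 2) Real.pi)
    (hr0 : ∀ m : ℕ, Real.cos (r m) + (m * Real.pi + r m) * Real.sin (r m) = 0) :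
    X = fun m : ℕ => m * Real.pi + r m := by
  have hπ := Real.pi_pos
  refine (hX_mono.range_inj (strictMono_nat_mul_pi_add hr)).1 (Subset.antisymm ?_ ?_)
  · rintro _ ⟨j, rfl⟩
    set t := X j with ht
    have htpos : 0 < t := hX_pos j
    set m := ⌊t / Real.pi⌋₊
    have h₁ : m * Real.pi ≤ t := by
      rw [← le_div_iff₀ hπ]; exact Nat.floor_le (by positivity)
    have h₂ : t < (m + 1) * Real.pi := by
      rw [← div_lt_iff₀ hπ]; exact Nat.lt_floor_add_one _
    obtain ⟨q, hq⟩ : ∃ q, t = m * Real.pi + q := ⟨t - m * Real.pi, by ring⟩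
    have hq0 : Real.cos q + (m * Real.pi + q) * Real.sin q = 0 := by
      have h := hX_root j
      rw [← ht, hq, cos_add_mul_sin_add_nat_mul_pi] at h
      exact (mul_eq_zero.1 h).resolve_left (pow_ne_zero _ (by norm_num))
    have hq1 : 0 ≤ q := by linarith
    have hq2 : q < Real.pi := by linarith
    have hqmem : q ∈ Icc (Real.pi / 2) Real.pi := by
      refine ⟨?_, hq2.le⟩
      by_contra! hlt
      have hc := Real.cos_pos_of_mem_Ioo ⟨by linarith, hlt⟩
      have hs := Real.sin_nonneg_of_nonneg_of_le_pi hq1 hq2.le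
      have : 0 ≤ (m * Real.pi + q) * Real.sin q := by positivity
      linarith
    refine ⟨m, ?_⟩
    have : r m = q := (strictAntiOn_cos_add_mul_sin m).injOn (hr m) hqmem
      ((hr0 m).trans hq0.symm)
    simp only [this, hq]
  · rintro _ ⟨m, rfl⟩
    obtain ⟨j, hj⟩ := hX_all (m * Real.pi + r m) (nat_mul_pi_add_pos m (hr m).1)
      (by rw [cos_add_mul_sin_add_nat_mul_pi, hr0, mul_zero])
    exact ⟨j, hj⟩

theorem tendsto_mul_tan_div_sub {θ : ℕ → ℝ} {b : ℝ} {n : ℕ → ℕ} (hn : Tendsto n atTop atTop)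
    (hθ : ∀ k, |θ k| ≤ b) :
    Tendsto (fun k => n k * Real.tan (θ k / n k) - θ k) atTop (𝓝 0) := by
  have hn' : Tendsto (fun k => (n k : ℝ)) atTop atTop := tendsto_natCast_atTop_atTop.comp hn
  have hy : Tendsto (fun k => θ k / n k) atTop (𝓝 0) := by
    refine squeeze_zero_norm (fun k => ?_) (hn'.const_div_atTop b)
    rw [norm_div, Real.norm_natCast]
    exact div_le_div_of_nonneg_right (hθ k) (Nat.cast_nonneg _)
  have hd : HasDerivAt Real.tan 1 0 := by
    simpa using Real.hasDerivAt_tan (x := 0) (by simp)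
  have ho := (hasDerivAt_iff_isLittleO.1 hd).comp_tendsto hy
  have hO : (fun k => θ k / n k - 0) =O[atTop] fun k => (n k : ℝ)⁻¹ := by
    refine Asymptotics.IsBigO.of_bound b (Eventually.of_forall fun k => ?_)
    rw [sub_zero, div_eq_mul_inv, norm_mul]
    exact mul_le_mul_of_nonneg_right (hθ k) (norm_nonneg _)
  have h := (ho.trans_isBigO hO).tendsto_inv_smul_nhds_zero
  refine h.congr' ?_
  filter_upwards [hn'.eventually_gt_atTop 0] with k hk
  simp
  field_simp

theorem tendsto_of_tan_secular_root {m : ℕ} {n : ℕ → ℕ} {ρ : ℕ → ℝ} {r : ℝ}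
    (hn : Tendsto n atTop atTop) (hρ : ∀ k, ρ k ∈ Icc (Real.pi / 2) Real.pi)
    (hρ0 : ∀ᶠ k in atTop, Real.cos (ρ k) +
      n k * Real.tan ((m * Real.pi + ρ k) / n k) * Real.sin (ρ k) = 0)
    (hr : r ∈ Icc (Real.pi / 2) Real.pi)
    (hr0 : Real.cos r + (m * Real.pi + r) * Real.sin r = 0) :
    Tendsto (fun k => n k * Real.tan ((m * Real.pi + ρ k) / n k)) atTop
      (𝓝 (m * Real.pi + r)) := by
  have hsub := tendsto_mul_tan_div_sub (θ := fun k => m * Real.pi + ρ k)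
    (b := m * Real.pi + Real.pi) hn fun k => by
      rw [abs_of_pos (nat_mul_pi_add_pos m (hρ k).1)]
      linarith [(hρ k).2]
  have hF : Tendsto (fun k => Real.cos (ρ k) + (m * Real.pi + ρ k) * Real.sin (ρ k)) atTop
      (𝓝 0) := by
    have h : Tendsto (fun k => Real.sin (ρ k) *
        (n k * Real.tan ((m * Real.pi + ρ k) / n k) - (m * Real.pi + ρ k))) atTop (𝓝 0) :=
      bdd_le_mul_tendsto_zero' 1 (Eventually.of_forall fun k => Real.abs_sin_le_one _) hsub
    rw [← neg_zero]
    refine h.neg.congr' ?_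
    filter_upwards [hρ0] with k hk
    linear_combination -hk
  have hlim : Tendsto ρ atTop (𝓝 r) := by
    refine isCompact_Icc.tendsto_nhds_of_unique_mapClusterPt (Eventually.of_forall hρ)
      fun x hx hcl => ?_
    obtain ⟨U, hU, hUx⟩ := mapClusterPt_iff_ultrafilter.1 hcl
    have hcont : Continuous fun r => Real.cos r + (m * Real.pi + r) * Real.sin r := by fun_prop
    have hx0 := tendsto_nhds_unique ((hcont.tendsto x).comp hUx) (hF.mono_left hU)
    exact (strictAntiOn_cos_add_mul_sin m).injOn hx hr (hx0.trans hr0.symm)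
  simpa using hsub.add (hlim.const_add (m * Real.pi))

theorem strictAntiOn_cosh_sub_mul_sinh :
    StrictAntiOn (fun a => Real.cosh a - a * Real.sinh a) (Ici 0) := by
  refine strictAntiOn_of_deriv_neg (convex_Ici _) (by fun_prop) fun a ha => ?_
  rw [interior_Ici] at ha
  have hd : HasDerivAt (fun a => Real.cosh a - a * Real.sinh a)
      (Real.sinh a - (1 * Real.sinh a + a * Real.cosh a)) a :=
    (Real.hasDerivAt_cosh a).sub ((hasDerivAt_id a).mul (Real.hasDerivAt_sinh a))
  rw [hd.deriv]
  nlinarith [mul_pos (show 0 < a from ha) (Real.cosh_pos a)]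

theorem tendsto_eval_neg_sq_secularPoly (a : ℝ) :
    Tendsto (fun n : ℕ => (secularPoly (1 / n) n).eval (-a ^ 2)) atTop
      (𝓝 (Real.cosh a - a * Real.sinh a)) := by
  have h₁ := Real.tendsto_one_add_div_pow_exp a
  have h₂ := Real.tendsto_one_add_div_pow_exp (-a)
  have h := ((h₂.const_mul (1 + a)).add (h₁.const_mul (1 - a))).div_const 2
  rw [Real.cosh_eq, Real.sinh_eq]
  convert h using 2 with n
  · rw [eval_neg_sq_secularPoly]
    ring
  · ring

theorem eventually_exists_neg_root_secularPoly {α ε : ℝ} (hα : 0 < α)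
    (hα_eq : Real.cosh α = α * Real.sinh α) (hε : 0 < ε) (hεα : ε < α) :
    ∀ᶠ n : ℕ in atTop, ∃ a ∈ Icc (α - ε) (α + ε), (secularPoly (1 / n) n).eval (-a ^ 2) = 0 := by
  have h₁ : 0 < Real.cosh (α - ε) - (α - ε) * Real.sinh (α - ε) := by
    have := strictAntiOn_cosh_sub_mul_sinh (show α - ε ∈ Ici 0 by simp; linarith)
      (show α ∈ Ici 0 from hα.le) (by linarith)
    simp only at this
    linarith
  have h₂ : Real.cosh (α + ε) - (α + ε) * Real.sinh (α + ε) < 0 := by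
    have := strictAntiOn_cosh_sub_mul_sinh (show α ∈ Ici 0 from hα.le)
      (show α + ε ∈ Ici 0 by simp; linarith) (by linarith)
    simp only at this
    linarith
  filter_upwards [(tendsto_eval_neg_sq_secularPoly _).eventually_const_lt h₁,
    (tendsto_eval_neg_sq_secularPoly _).eventually_lt_const h₂] with n hn₁ hn₂
  obtain ⟨a, ha, ha0⟩ := intermediate_value_Icc' (by linarith : α - ε ≤ α + ε)
    (f := fun a => (secularPoly (1 / n) n).eval (-a ^ 2))
    ((secularPoly (1 / n) n).continuous.comp (by fun_prop)).continuousOn ⟨hn₂.le, hn₁.le⟩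
  exact ⟨a, ha, ha0⟩

theorem tan_secular_root_props {M : ℕ} {r : ℕ → ℝ} (hr : ∀ m, r m ∈ Icc (Real.pi / 2) Real.pi)
    (hr0 : ∀ m < M, Real.cos (r m) + (2 * M + 1 : ℕ) *
      Real.tan ((m * Real.pi + r m) / (2 * M + 1 : ℕ)) * Real.sin (r m) = 0) :
    (∀ m < M, (m : ℝ) + 1 ≤
        (2 * M + 1 : ℕ) * Real.tan ((m * Real.pi + r m) / (2 * M + 1 : ℕ))) ∧
      StrictMonoOn
        (fun m : ℕ => (2 * M + 1 : ℕ) * Real.tan ((m * Real.pi + r m) / (2 * M + 1 : ℕ)))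
        (Iio M) ∧
      ∀ m < M, (secularPoly (1 / (2 * M + 1 : ℕ)) (2 * M + 1)).eval
        (((2 * M + 1 : ℕ) * Real.tan ((m * Real.pi + r m) / (2 * M + 1 : ℕ))) ^ 2) = 0 := by
  have hπ := Real.pi_gt_three
  have hn : (0 : ℝ) < (2 * M + 1 : ℕ) := by positivity
  have hφ : ∀ m < M, 0 < (m * Real.pi + r m) / (2 * M + 1 : ℕ) ∧
      (m * Real.pi + r m) / (2 * M + 1 : ℕ) < Real.pi / 2 := by
    intro m hm
    obtain ⟨h₁, h₂⟩ := hr m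
    have hm' : (m : ℝ) + 1 ≤ M := by exact_mod_cast hm
    refine ⟨div_pos (nat_mul_pi_add_pos m h₁) hn, ?_⟩
    rw [div_lt_iff₀ hn]
    push_cast
    nlinarith
  refine ⟨fun m hm => ?_, fun i hi j hj hij => ?_, fun m hm => ?_⟩
  · have h := Real.le_tan (hφ m hm).1.le (hφ m hm).2
    rw [div_le_iff₀' hn] at h
    exact (add_one_le_nat_mul_pi_add m (hr m).1).trans h
  · refine mul_lt_mul_of_pos_left ?_ hn
    refine Real.tan_lt_tan_of_nonneg_of_lt_pi_div_two (hφ i hi).1.le (hφ j hj).2 ?_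
    exact div_lt_div_of_pos_right (strictMono_nat_mul_pi_add hr hij) hn
  · set φ := (m * Real.pi + r m) / (2 * M + 1 : ℕ) with hφdef
    have hcos : 0 < Real.cos φ :=
      Real.cos_pos_of_mem_Ioo ⟨by linarith [(hφ m hm).1], (hφ m hm).2⟩
    have hs : 1 / ((2 * M + 1 : ℕ) : ℝ) * ((2 * M + 1 : ℕ) * Real.tan φ) * Real.cos φ =
        Real.sin φ := by
      rw [Real.tan_eq_sin_div_cos]; field_simp
    have h := eval_sq_secularPoly hs (2 * M + 1)
    have hmul : ((2 * M + 1 : ℕ) : ℝ) * φ = m * Real.pi + r m := by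
      rw [hφdef]; field_simp
    rw [hmul, cos_add_mul_sin_add_nat_mul_pi, hr0 m hm, mul_zero] at h
    exact (mul_eq_zero.1 h).resolve_right (pow_ne_zero _ hcos.ne')

theorem summable_and_tsum_inv_sq_secular {α : ℝ} (hα : 0 < α)
    (hα_eq : Real.cosh α = α * Real.sinh α) {r : ℕ → ℝ}
    (hr : ∀ m, r m ∈ Icc (Real.pi / 2) Real.pi)
    (hr0 : ∀ m : ℕ, Real.cos (r m) + (m * Real.pi + r m) * Real.sin (r m) = 0) :
    Summable (fun m : ℕ => 1 / (m * Real.pi + r m) ^ 2) ∧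
      ∑' m : ℕ, 1 / (m * Real.pi + r m) ^ 2 = 1 / α ^ 2 - 1 / 2 := by
  have hbound : Summable fun m : ℕ => 1 / ((m : ℝ) + 1) ^ 2 := by
    simpa using (summable_nat_add_iff 1).2 (Real.summable_one_div_nat_pow.2 one_lt_two)
  have hle : ∀ m : ℕ, (m : ℝ) + 1 ≤ m * Real.pi + r m := fun m => add_one_le_nat_mul_pi_add m (hr m).1
  refine ⟨hbound.of_nonneg_of_le (fun m => by positivity) fun m =>
    one_div_le_one_div_of_le (by positivity) (pow_le_pow_left₀ (by positivity) (hle m) 2), ?_⟩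
  have hex : ∀ M m : ℕ, ∃ q ∈ Icc (Real.pi / 2) Real.pi, m < M →
      Real.cos q + (2 * M + 1 : ℕ) * Real.tan ((m * Real.pi + q) / (2 * M + 1 : ℕ)) *
        Real.sin q = 0 := by
    intro M m
    by_cases hm : m < M
    · obtain ⟨q, hq, hq0⟩ := exists_tan_secular_root (by omega : 2 * (m + 1) < 2 * M + 1)
      exact ⟨q, hq, fun _ => hq0⟩
    · exact ⟨r m, hr m, fun h => absurd h hm⟩
  choose ρ hρ hρ0 using hex
  set z : ℕ → ℕ → ℝ := fun M m =>
    (2 * M + 1 : ℕ) * Real.tan ((m * Real.pi + ρ M m) / (2 * M + 1 : ℕ)) with hz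
  have hn : Tendsto (fun M : ℕ => 2 * M + 1) atTop atTop :=
    tendsto_atTop_mono (fun M => by simp only [id]; omega) tendsto_id
  have hprops := fun M => tan_secular_root_props (hρ M) (hρ0 M)
  have hzpos : ∀ M m, m < M → 0 < z M m := fun M m hm =>
    lt_of_lt_of_le (by positivity) ((hprops M).1 m hm)
  have hlim : ∀ m, Tendsto (fun M => if m < M then 1 / z M m ^ 2 else 0) atTop
      (𝓝 (1 / (m * Real.pi + r m) ^ 2)) := by
    intro m
    have hzm : Tendsto (fun M => z M m) atTop (𝓝 (m * Real.pi + r m)) :=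
      tendsto_of_tan_secular_root hn (fun M => hρ M m)
        ((eventually_gt_atTop m).mono fun M hM => hρ0 M m hM) (hr m) (hr0 m)
    have hne : (m * Real.pi + r m) ^ 2 ≠ 0 :=
      pow_ne_zero _ (lt_of_lt_of_le (by positivity) (hle m)).ne'
    refine (tendsto_const_nhds.div (hzm.pow 2) hne).congr' ?_
    filter_upwards [eventually_gt_atTop m] with M hM
    simp [hM]
  have htannery := tendsto_tsum_of_dominated_convergence hbound hlim
    (Eventually.of_forall fun M m => by
      split_ifs with hm
      · rw [Real.norm_of_nonneg (by positivity)]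
        gcongr
        exact (hprops M).1 m hm
      · rw [norm_zero]; positivity)
  have hsum : ∀ M, ∑' m, (if m < M then 1 / z M m ^ 2 else 0) =
      ∑ m ∈ Finset.range M, 1 / z M m ^ 2 := by
    intro M
    rw [tsum_eq_sum (s := Finset.range M) fun m hm => if_neg (by simpa using hm)]
    exact Finset.sum_congr rfl fun m hm => if_pos (Finset.mem_range.1 hm)
  simp only [hsum] at htannery
  have herr : Tendsto (fun M : ℕ => 1 / 2 + 1 / (2 * (2 * (M : ℝ) + 1))) atTop
      (𝓝 (1 / 2 + 0)) := by
    refine Tendsto.const_add _ (Tendsto.const_div_atTop ?_ 1)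
    refine tendsto_atTop_mono (fun M : ℕ => ?_) tendsto_natCast_atTop_atTop
    have : (0 : ℝ) ≤ M := Nat.cast_nonneg M
    linarith
  have hα_lim : Tendsto (fun M : ℕ => ∑ m ∈ Finset.range M, 1 / z M m ^ 2 +
      (1 / 2 + 1 / (2 * (2 * (M : ℝ) + 1)))) atTop (𝓝 (1 / α ^ 2)) := by
    intro U hU
    have hcont : ContinuousAt (fun a : ℝ => 1 / a ^ 2) α :=
      continuousAt_const.div (continuousAt_id.pow 2) (pow_ne_zero _ hα.ne')
    obtain ⟨δ, hδ, hball⟩ := Metric.mem_nhds_iff.1 (hcont hU)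
    have hmin : 0 < min δ α := lt_min hδ hα
    have hev := hn.eventually (eventually_exists_neg_root_secularPoly hα hα_eq
      (half_pos hmin) ((half_lt_self hmin).trans_le (min_le_right _ _)))
    rw [mem_map]
    filter_upwards [hev] with M hM
    obtain ⟨a, ⟨ha₁, ha₂⟩, ha0⟩ := hM
    have h₁ := min_le_left δ α
    have h₂ := min_le_right δ α
    have haU : 1 / a ^ 2 ∈ U := hball (by
      rw [Metric.mem_ball, Real.dist_eq, abs_lt]
      constructor <;> linarith)
    have hsumM := sum_inv_sq_of_secularPoly_roots (by linarith : 0 < a) (hzpos M)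
      (hprops M).2.1 ha0 (hprops M).2.2
    rw [mem_preimage, hsumM]
    convert haU using 1
    ring
  have := tendsto_nhds_unique hα_lim (htannery.add herr)
  linarith

/-- `∑_{m≥1} 1/x_m² = 1/α² - 1/2`, where `α` is the unique positive solution
of `cosh α = α sinh α` and `X 0 < X 1 < ⋯` enumerates the positive roots of
`cos t + t sin t = 0` (so `X m` is the classical `x_{m+1}`). -/
theorem sum_of_reciprocal_squares_of_secular_roots
    (α : ℝ) (hα_pos : 0 < α) (hα_eq : Real.cosh α = α * Real.sinh α)
    (X : ℕ → ℝ) (hX_mono : StrictMono X) (hX_pos : ∀ m, 0 < X m)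
    (hX_root : ∀ m, Real.cos (X m) + X m * Real.sin (X m) = 0)
    (hX_all : ∀ t : ℝ, 0 < t → Real.cos t + t * Real.sin t = 0 → ∃ m, X m = t) :
    Summable (fun m : ℕ => 1 / (X m) ^ 2) ∧
    ∑' m : ℕ, 1 / (X m) ^ 2 = 1 / α ^ 2 - 1 / 2 := by
  choose r hr hr0 using exists_cos_add_mul_sin_eq_zero
  rw [eq_of_secular_enumeration hX_mono hX_pos hX_root hX_all hr hr0]
  exact summable_and_tsum_inv_sq_secular hα_pos hα_eq hr hr0
end

section
/- Let α be the unique positive real number satisfying cosh α = α·sinh α, let (x_m)_{m≥1} be the strictly increasing enumeration of the positive solutions of cos x + x·sin x = 0, and define the eigenvalue sequence (λ_n)_{n≥0} by λ₀ = −4α², λ_{2m−1} = (2m−1)²π², and λ_{2m} = 4x_m² for m ≥ 1. Then the series Σ_{n=0}^∞ 1/λ_n converges absolutely and Σ_{n=0}^∞ 1/λ_n = 0. -/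
open Filter Topology Polynomial

/-- Partial fraction expansion of the tangent. -/
lemma hasSum_tan_partial_fractions {z : ℂ} (hz : 2 * z ∈ Complex.integerComplement) :
    HasSum (fun k : ℕ => 4 * z / (4 * z ^ 2 - (2 * (k : ℂ) + 1) ^ 2))
      (-(Real.pi / 2 * Complex.tan (Real.pi * z))) := by
  have hz1 : z ∈ Complex.integerComplement := by
    rw [Complex.mem_integerComplement_iff] at hz ⊢
    rintro ⟨n, hn⟩
    exact hz ⟨2 * n, by push_cast; rw [hn]⟩
  have hz0 : z ≠ 0 := Complex.integerComplement.ne_zero hz1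
  have h2 := (summable_cotTerm hz).hasSum
  have h1 := (summable_cotTerm hz1).hasSum
  have e2 : ∑' n, cotTerm (2 * z) n = _ := (cot_series_rep' hz).symm
  have e1 : ∑' n, cotTerm z n = _ := (cot_series_rep' hz1).symm
  rw [e2] at h2
  rw [e1] at h1
  have he : Summable fun k : ℕ => cotTerm (2 * z) (2 * k) :=
    h2.summable.comp_injective (mul_right_injective₀ (two_ne_zero))
  have ho : HasSum (fun k : ℕ => cotTerm (2 * z) (2 * k + 1))
      (1 / 2 * (Real.pi * Complex.cot (Real.pi * z) - 1 / z)) := by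
    refine (h1.mul_left (1 / 2)).congr_fun ?_
    intro k
    rw [cotTerm_identity hz, cotTerm_identity hz1]
    push_cast
    have a1 := Complex.integerComplement_add_ne_zero hz1 (k + 1)
    have a2 := Complex.integerComplement_add_ne_zero hz1 (-(k + 1))
    push_cast at a1 a2
    rw [← sub_eq_add_neg] at a2
    rw [show (2 * z + (2 * (k : ℂ) + 1 + 1)) = 2 * (z + (k + 1)) by ring,
      show (2 * z - (2 * (k : ℂ) + 1 + 1)) = 2 * (z - (k + 1)) by ring]
    field_simp
  have hsum := (he.hasSum.even_add_odd ho).unique h2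
  have hs := sin_pi_mul_ne_zero hz
  have hc : Complex.sin (Real.pi * (2 * z)) =
      2 * Complex.sin (Real.pi * z) * Complex.cos (Real.pi * z) := by
    rw [← Complex.sin_two_mul]; ring_nf
  have hc' : Complex.cos (Real.pi * (2 * z)) =
      Complex.cos (Real.pi * z) ^ 2 - Complex.sin (Real.pi * z) ^ 2 := by
    rw [← Complex.cos_two_mul']; ring_nf
  have hs1 : Complex.sin (Real.pi * z) ≠ 0 := by
    intro h; simp [hc, h] at hs
  have hc1 : Complex.cos (Real.pi * z) ≠ 0 := by
    intro h; simp [hc, h] at hs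
  have hv : ∑' k : ℕ, cotTerm (2 * z) (2 * k) =
      -(Real.pi / 2 * Complex.tan (Real.pi * z)) := by
    rw [eq_sub_of_add_eq hsum, Complex.cot_eq_cos_div_sin, Complex.cot_eq_cos_div_sin,
      Complex.tan_eq_sin_div_cos, hc, hc']
    field_simp
    ring
  rw [← hv]
  refine he.hasSum.congr_fun fun k => ?_
  rw [cotTerm_identity hz]
  push_cast
  ring_nf

/-- If `cos y + y sin y = 0` and `u = y⁻²` is real, then `u` solves the secular equation. -/
lemma hasSum_secular_of_root {y : ℂ} (hy : y ≠ 0) (h : Complex.cos y + y * Complex.sin y = 0)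
    {u : ℝ} (hu : (u : ℂ) * y ^ 2 = 1) :
    HasSum (fun k : ℕ => 2 * (4 / ((2 * (k : ℝ) + 1) ^ 2 * Real.pi ^ 2)) /
      (u - 4 / ((2 * (k : ℝ) + 1) ^ 2 * Real.pi ^ 2))) (-1) := by
  have hpi : (Real.pi : ℂ) ≠ 0 := by exact_mod_cast Real.pi_ne_zero
  have hsc := Complex.sin_sq_add_cos_sq y
  have hs : Complex.sin y ≠ 0 := by
    intro h0
    rw [h0] at h hsc
    simp only [mul_zero, add_zero] at h
    simp [h] at hsc
  have hc : Complex.cos y ≠ 0 := by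
    intro h0
    rw [h0, zero_add] at h
    exact (mul_ne_zero hy hs) h
  set z : ℂ := y / Real.pi with hzdef
  have hyz : y = Real.pi * z := by rw [hzdef]; field_simp
  have hz0 : z ≠ 0 := by rw [hzdef]; positivity
  have hz : 2 * z ∈ Complex.integerComplement := by
    rw [Complex.mem_integerComplement_iff]
    rintro ⟨n, hn⟩
    have h1 : Complex.sin (2 * y) = 0 := by
      rw [Complex.sin_eq_zero_iff]
      exact ⟨n, by rw [hn, hyz]; ring⟩
    rw [Complex.sin_two_mul] at h1
    exact mul_ne_zero (mul_ne_zero two_ne_zero hs) hc h1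
  have key := (hasSum_tan_partial_fractions hz).mul_left (-2 * z)
  have hval : -2 * z * -(Real.pi / 2 * Complex.tan (Real.pi * z)) = ((-1 : ℝ) : ℂ) := by
    rw [← hyz, Complex.tan_eq_sin_div_cos, hzdef]
    push_cast
    field_simp
    linear_combination h
  rw [hval] at key
  rw [← Complex.hasSum_ofReal]
  refine key.congr_fun fun k => ?_
  have hk : (2 * (k : ℂ) + 1) ≠ 0 := by exact_mod_cast Nat.succ_ne_zero (2 * k)
  have hd : 4 * z ^ 2 - (2 * (k : ℂ) + 1) ^ 2 ≠ 0 := by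
    have a1 := Complex.integerComplement_add_ne_zero hz (2 * k + 1)
    have a2 := Complex.integerComplement_add_ne_zero hz (-(2 * k + 1))
    push_cast at a1 a2
    intro h0
    apply mul_ne_zero a1 a2
    linear_combination h0
  have hu' : (u : ℂ) = 1 / (Real.pi * z) ^ 2 := by
    rw [eq_div_iff (by positivity), ← hyz, hu]
  push_cast
  rw [hu']
  have hd' : (2 * (k : ℂ) + 1) ^ 2 - 4 * z ^ 2 ≠ 0 := by
    intro h0; apply hd; linear_combination -h0
  have e : 1 / ((Real.pi : ℂ) * z) ^ 2 - 4 / ((2 * (k : ℂ) + 1) ^ 2 * Real.pi ^ 2) =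
      ((2 * (k : ℂ) + 1) ^ 2 - 4 * z ^ 2) / (Real.pi ^ 2 * z ^ 2 * (2 * (k : ℂ) + 1) ^ 2) := by
    field_simp
  rw [e, div_div_eq_mul_div, div_eq_iff hd',
    show 4 * z ^ 2 - (2 * (k : ℂ) + 1) ^ 2 = -((2 * (k : ℂ) + 1) ^ 2 - 4 * z ^ 2) by ring, div_neg]
  field_simp

/-- The sum of the roots of a secular equation `1 + ∑ cⱼ / (x - qⱼ) = 0`. -/
lemma sum_roots_secular {ι : Type*} [DecidableEq ι] (s : Finset ι) (hs : 0 < s.card)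
    {q c w : ι → ℝ} (hw : Set.InjOn w s) (hwq : ∀ i ∈ s, ∀ j ∈ s, w i ≠ q j)
    (h : ∀ i ∈ s, ∑ j ∈ s, c j / (w i - q j) = -1) :
    ∑ i ∈ s, w i = ∑ i ∈ s, q i - ∑ i ∈ s, c i := by
  set D : ℝ[X] := ∏ j ∈ s, (X - C (q j)) with hD
  set W : ℝ[X] := ∏ j ∈ s, (X - C (w j)) with hW
  set R : ℝ[X] := ∑ k ∈ s, C (c k) * ∏ j ∈ s.erase k, (X - C (q j)) with hR
  have hdeg : ∀ k ∈ s, (∏ j ∈ s.erase k, (X - C (q j))).natDegree = s.card - 1 := by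
    intro k hk
    rw [natDegree_prod_of_monic _ _ fun i _ => monic_X_sub_C _]
    simp [Finset.card_erase_of_mem hk]
  have hRdeg : R.degree < s.card := by
    rw [degree_lt_iff_coeff_zero]
    intro m hm
    rw [hR, finsetSum_coeff]
    refine Finset.sum_eq_zero fun k hk => ?_
    rw [coeff_C_mul, coeff_eq_zero_of_natDegree_lt, mul_zero]
    rw [hdeg k hk]; omega
  have hDd : D.degree = s.card := by simp [hD, degree_prod]
  have hWd : W.degree = s.card := by simp [hW, degree_prod]
  have hDm : D.Monic := monic_prod_of_monic _ _ fun i _ => monic_X_sub_C _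
  have hWm : W.Monic := monic_prod_of_monic _ _ fun i _ => monic_X_sub_C _
  have hEq : D + R = W := by
    refine eq_of_degree_sub_lt_of_eval_index_eq s hw ?_ ?_
    · rw [add_sub_right_comm]
      refine lt_of_le_of_lt (degree_add_le _ _) (max_lt ?_ hRdeg)
      rw [← hDd]
      exact degree_sub_lt_left (hDd.trans hWd.symm) hDm.ne_zero
        (by rw [hDm.leadingCoeff, hWm.leadingCoeff])
    · intro i hi
      have hne : ∀ j ∈ s, w i - q j ≠ 0 := fun j hj => sub_ne_zero.2 (hwq i hi j hj)
      have h1 : W.eval (w i) = 0 := by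
        rw [hW, eval_prod]
        exact Finset.prod_eq_zero hi (by simp)
      have h2 : R.eval (w i) = D.eval (w i) * ∑ j ∈ s, c j / (w i - q j) := by
        rw [hR, hD, eval_finsetSum, Finset.mul_sum]
        refine Finset.sum_congr rfl fun k hk => ?_
        rw [eval_mul, eval_C, eval_prod, eval_prod, ← Finset.mul_prod_erase s _ hk]
        have := hne k hk
        simp only [eval_sub, eval_X, eval_C]
        field_simp
      rw [eval_add, h1, h2, h i hi]
      ring
  have hRc : R.coeff (s.card - 1) = ∑ k ∈ s, c k := by
    rw [hR, finsetSum_coeff]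
    refine Finset.sum_congr rfl fun k hk => ?_
    rw [coeff_C_mul, ← hdeg k hk, coeff_natDegree,
      (monic_prod_of_monic _ _ fun i _ => monic_X_sub_C _ : Monic _).leadingCoeff, mul_one]
  have := congrArg (fun p => p.coeff (s.card - 1)) hEq
  simp only [coeff_add] at this
  rw [hRc, hD, hW, prod_X_sub_C_coeff_card_pred _ _ hs, prod_X_sub_C_coeff_card_pred _ _ hs] at this
  linarith

/-- Between two consecutive poles with positive weights the secular equation has a root. -/
lemma exists_root_between_poles {ι : Type*} [DecidableEq ι] {s : Finset ι} {q c : ι → ℝ} {i j : ι}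
    (hi : i ∈ s) (hj : j ∈ s) (hij : q i < q j) (hci : 0 < c i) (hcj : 0 < c j)
    (hq : ∀ l ∈ s, l ≠ i → l ≠ j → q l ∉ Set.Icc (q i) (q j)) :
    ∃ x ∈ Set.Ioo (q i) (q j), ∑ l ∈ s, c l / (x - q l) = -1 := by
  have hji : j ∈ s.erase i := Finset.mem_erase.2 ⟨fun h => hij.ne (by rw [h]), hj⟩
  set g : ℝ → ℝ := fun x => (x - q i) * (q j - x) *
    (1 + ∑ l ∈ (s.erase i).erase j, c l / (x - q l)) + c i * (q j - x) - c j * (x - q i) with hg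
  have hcont : ContinuousOn g (Set.Icc (q i) (q j)) := by
    have : ContinuousOn (fun x => ∑ l ∈ (s.erase i).erase j, c l / (x - q l))
        (Set.Icc (q i) (q j)) := by
      refine continuousOn_finsetSum _ fun l hl => ?_
      refine ContinuousOn.div (by fun_prop) (by fun_prop) fun x hx h0 => ?_
      simp only [Finset.mem_erase] at hl
      exact hq l hl.2.2 hl.2.1 hl.1 (by rwa [← sub_eq_zero.1 h0])
    fun_prop
  have h0 : (0 : ℝ) ∈ Set.Ioo (g (q j)) (g (q i)) := by
    constructor
    · simp only [hg, sub_self]; nlinarith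
    · simp only [hg, sub_self]; nlinarith
  obtain ⟨x, hx, hx0⟩ := intermediate_value_Ioo' hij.le hcont h0
  refine ⟨x, hx, ?_⟩
  rw [← Finset.add_sum_erase s _ hi, ← Finset.add_sum_erase _ _ hji]
  have h1 : x - q i ≠ 0 := (sub_pos.2 hx.1).ne'
  have h2 : q j - x ≠ 0 := (sub_pos.2 hx.2).ne'
  have h3 : x - q j ≠ 0 := (sub_neg.2 hx.2).ne
  have e : g x = (x - q i) * (q j - x) * (1 + (c i / (x - q i) + (c j / (x - q j) +
      ∑ l ∈ (s.erase i).erase j, c l / (x - q l)))) := by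
    simp only [hg]
    field_simp
    ring
  rw [e] at hx0
  have := (mul_eq_zero.1 hx0).resolve_left (mul_ne_zero h1 h2)
  linarith

/-- If the weights are large, the secular equation with positive poles has a negative root. -/
lemma exists_neg_root {ι : Type*} {s : Finset ι} {q c : ι → ℝ} (hq : ∀ i ∈ s, 0 < q i)
    (hc : ∀ i ∈ s, 0 < c i) (h : 1 < ∑ i ∈ s, c i / q i) :
    ∃ x < 0, ∑ l ∈ s, c l / (x - q l) = -1 := by
  set S := ∑ i ∈ s, c i
  have hS : 0 ≤ S := Finset.sum_nonneg fun i hi => (hc i hi).le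
  have hcont : ContinuousOn (fun x => ∑ l ∈ s, c l / (x - q l)) (Set.Icc (-(1 + S)) 0) := by
    refine continuousOn_finsetSum _ fun l hl => ?_
    refine ContinuousOn.div (by fun_prop) (by fun_prop) fun x hx h0 => ?_
    linarith [hx.2, hq l hl]
  have hmem : (-1 : ℝ) ∈ Set.Ioo (∑ l ∈ s, c l / (0 - q l))
      (∑ l ∈ s, c l / (-(1 + S) - q l)) := by
    constructor
    · simp only [zero_sub, div_neg, Finset.sum_neg_distrib]
      linarith
    · have h1 : ∀ l ∈ s, -(c l / (1 + S)) ≤ c l / (-(1 + S) - q l) := by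
        intro l hl
        have := hq l hl
        have := hc l hl
        rw [show -(1 + S) - q l = -(1 + S + q l) by ring, div_neg]
        exact neg_le_neg (div_le_div_of_nonneg_left this.le (by linarith) (by linarith))
      have h2 := Finset.sum_le_sum h1
      rw [Finset.sum_neg_distrib, ← Finset.sum_div] at h2
      have h3 : S / (1 + S) < 1 := by rw [div_lt_one (by linarith)]; linarith
      change -(S / (1 + S)) ≤ _ at h2
      linarith
  obtain ⟨x, hx, hx0⟩ := intermediate_value_Ioo' (by linarith) hcont hmem
  exact ⟨x, hx.2, hx0⟩

lemma div_sub_lt_div_sub {a b q c : ℝ} (hc : 0 < c) (hab : a < b)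
    (h : 0 < (a - q) * (b - q)) : c / (b - q) < c / (a - q) := by
  have ha : a - q ≠ 0 := left_ne_zero_of_mul h.ne'
  have hb : b - q ≠ 0 := right_ne_zero_of_mul h.ne'
  rw [← sub_pos, div_sub_div _ _ ha hb]
  exact div_pos (by nlinarith) h

/-- On a region free of poles, a root of the infinite secular equation is unique. -/
lemma secular_root_unique {q c : ℕ → ℝ} (hc : ∀ j, 0 < c j) {a b : ℝ}
    (h : ∀ j, 0 < (a - q j) * (b - q j)) (hab : a < b) {A : ℝ}
    (ha : HasSum (fun j => c j / (a - q j)) A) (hb : HasSum (fun j => c j / (b - q j)) A) :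
    False :=
  (hasSum_lt (fun j => (div_sub_lt_div_sub (hc j) hab (h j)).le)
    (div_sub_lt_div_sub (hc 0) hab (h 0)) hb ha).false

/-- Roots of truncated secular equations converge to the root of the infinite one. -/
lemma tendsto_truncated_root {q c : ℕ → ℝ} (hc : ∀ j, 0 < c j) {I : Set ℝ} {u : ℝ}
    (hI : I ∈ 𝓝 u) (hsep : ∀ x ∈ I, ∀ y ∈ I, ∀ j, 0 < (x - q j) * (y - q j))
    (hu : HasSum (fun j => c j / (u - q j)) (-1)) {w : ℕ → ℝ}
    (hw : ∀ᶠ N in atTop, w N ∈ I ∧ ∑ j ∈ Finset.range (N + 1), c j / (w N - q j) = -1) :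
    Tendsto w atTop (𝓝 u) := by
  have huI : u ∈ I := mem_of_mem_nhds hI
  have hlim : Tendsto (fun N => ∑ j ∈ Finset.range (N + 1), c j / (u - q j)) atTop (𝓝 (-1)) :=
    hu.tendsto_sum_nat.comp (tendsto_add_atTop_nat 1)
  have hgap : ∀ a ∈ I, ∀ b ∈ I, a < b → ∀ N : ℕ,
      c 0 / (a - q 0) - c 0 / (b - q 0) ≤
      ∑ j ∈ Finset.range (N + 1), c j / (a - q j) - ∑ j ∈ Finset.range (N + 1), c j / (b - q j) := by
    intro a ha b hb hab N
    rw [← Finset.sum_sub_distrib]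
    exact Finset.single_le_sum (f := fun j => c j / (a - q j) - c j / (b - q j))
      (fun j _ => sub_nonneg.2 (div_sub_lt_div_sub (hc j) hab (hsep a ha b hb j)).le)
      (Finset.mem_range.2 N.succ_pos)
  have hanti : ∀ a ∈ I, ∀ b ∈ I, a ≤ b → ∀ N : ℕ,
      ∑ j ∈ Finset.range (N + 1), c j / (b - q j) ≤ ∑ j ∈ Finset.range (N + 1), c j / (a - q j) := by
    intro a ha b hb hab N
    rcases hab.eq_or_lt with rfl | hab
    · rfl
    · exact Finset.sum_le_sum fun j _ => (div_sub_lt_div_sub (hc j) hab (hsep a ha b hb j)).le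
  refine tendsto_order.2 ⟨fun a hau => ?_, fun b hub => ?_⟩
  · obtain ⟨a', ha', haI⟩ :=
      (Filter.Eventually.and (Ioo_mem_nhdsLT hau) (mem_nhdsWithin_of_mem_nhds hI)).exists
    have h0 := div_sub_lt_div_sub (hc 0) ha'.2 (hsep a' haI u huI 0)
    filter_upwards [hw, hlim.eventually_const_lt
      (show -1 - (c 0 / (a' - q 0) - c 0 / (u - q 0)) < -1 by linarith)] with N hN hlt
    by_contra! hle
    have := hanti _ hN.1 _ haI (hle.trans ha'.1.le) N
    linarith [hgap a' haI u huI ha'.2 N, hN.2]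
  · obtain ⟨b', hb', hbI⟩ :=
      (Filter.Eventually.and (Ioo_mem_nhdsGT hub) (mem_nhdsWithin_of_mem_nhds hI)).exists
    have h0 := div_sub_lt_div_sub (hc 0) hb'.1 (hsep u huI b' hbI 0)
    filter_upwards [hw, hlim.eventually_lt_const
      (show -1 < -1 + (c 0 / (u - q 0) - c 0 / (b' - q 0)) by linarith)] with N hN hlt
    by_contra! hle
    have := hanti _ hbI _ hN.1 (hb'.2.le.trans hle) N
    linarith [hgap u huI b' hbI hb'.1 N, hN.2]

/-- The sum of all roots of an infinite secular equation. -/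
theorem hasSum_secular_roots {q c : ℕ → ℝ} (hq : ∀ j, 0 < q j) (hanti : StrictAnti q)
    (hqs : Summable q) (hc : ∀ j, 0 < c j) (hcs : Summable c) (hcq : q 0 < c 0)
    {u : ℕ → ℝ} (hu : ∀ k, u k ∈ Set.Ioo (q (k + 1)) (q k))
    (husum : ∀ k, HasSum (fun j => c j / (u k - q j)) (-1))
    {v : ℝ} (hv : v < 0) (hvsum : HasSum (fun j => c j / (v - q j)) (-1)) :
    HasSum u (∑' j, q j - ∑' j, c j - v) := by
  have hw : ∀ N k : ℕ, ∃ x, k < N → x ∈ Set.Ioo (q (k + 1)) (q k) ∧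
      ∑ j ∈ Finset.range (N + 1), c j / (x - q j) = -1 := by
    intro N k
    by_cases hk : k < N
    · obtain ⟨x, hx⟩ := exists_root_between_poles (s := Finset.range (N + 1)) (q := q) (c := c)
        (i := k + 1) (j := k) (by simpa using hk) (by simp; omega) (hanti k.lt_succ_self)
        (hc _) (hc _) (fun l _ h1 h2 hl => by
          have := hanti.le_iff_ge.1 hl.1
          have := hanti.le_iff_ge.1 hl.2
          omega)
      exact ⟨x, fun _ => hx⟩
    · exact ⟨0, fun h => absurd h hk⟩
  choose w hw using hw
  have hz : ∀ N : ℕ, ∃ x < 0, ∑ j ∈ Finset.range (N + 1), c j / (x - q j) = -1 := fun N =>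
    exists_neg_root (fun i _ => hq i) (fun i _ => hc i)
      (((one_lt_div (hq 0)).2 hcq).trans_le
        (Finset.single_le_sum (f := fun i => c i / q i) (fun i _ => (div_pos (hc i) (hq i)).le)
          (Finset.mem_range.2 N.succ_pos)))
  choose z hz0 hz using hz
  have hwq : ∀ N k, k < N → ∀ j, w N k ≠ q j := by
    intro N k hk j h
    have := (hw N k hk).1
    rw [h] at this
    have h1 := hanti.lt_iff_gt.1 this.1
    have h2 := hanti.lt_iff_gt.1 this.2
    omega
  have hsum : ∀ N : ℕ, ∑ k ∈ Finset.range N, w N k + z N =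
      ∑ j ∈ Finset.range (N + 1), q j - ∑ j ∈ Finset.range (N + 1), c j := by
    intro N
    have := sum_roots_secular (Finset.range (N + 1)) (by simp) (q := q) (c := c)
      (w := fun i => Nat.casesOn i (z N) (w N)) ?_ ?_ ?_
    · rwa [Finset.sum_range_succ'] at this
    · have hlt : ∀ k k', k < k' → k' < N → w N k' < w N k := fun k k' h h' =>
        ((hw N k' h').1.2.trans_le (hanti.antitone h)).trans (hw N k (h.trans h')).1.1
      have hpos : ∀ k < N, 0 < w N k := fun k hk => (hq _).trans (hw N k hk).1.1
      rintro (_ | i) hi (_ | j) hj h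
      · rfl
      · have := hpos j (by simpa using hj)
        have := hz0 N
        change z N = w N j at h
        linarith
      · have := hpos i (by simpa using hi)
        have := hz0 N
        change w N i = z N at h
        linarith
      · simp only [Finset.coe_range, Set.mem_Iio, add_lt_add_iff_right] at hi hj
        simp only at h
        rcases lt_trichotomy i j with hij | hij | hij
        · exact absurd h (hlt i j hij hj).ne'
        · rw [hij]
        · exact absurd h (hlt j i hij hi).ne
    · rintro (_ | i) hi j -
      · exact ((hz0 N).trans (hq j)).ne
      · exact hwq N i (by simpa using hi) j
    · rintro (_ | i) hi
      · exact hz N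
      · exact (hw N i (by simpa using hi)).2
  have hzlim : Tendsto z atTop (𝓝 v) :=
    tendsto_truncated_root hc (Iio_mem_nhds hv)
      (fun x hx y hy j => mul_pos_of_neg_of_neg (sub_neg.2 ((Set.mem_Iio.1 hx).trans (hq j)))
        (sub_neg.2 ((Set.mem_Iio.1 hy).trans (hq j))))
      hvsum (Eventually.of_forall fun N => ⟨hz0 N, hz N⟩)
  have hwlim : ∀ k, Tendsto (fun N => w N k) atTop (𝓝 (u k)) := by
    intro k
    refine tendsto_truncated_root hc (Ioo_mem_nhds (hu k).1 (hu k).2) (fun x hx y hy j => ?_)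
      (husum k) ((eventually_gt_atTop k).mono fun N hN => hw N k hN)
    rcases le_or_gt j k with hj | hj
    · have := hanti.antitone hj
      exact mul_pos_of_neg_of_neg (by linarith [hx.2]) (by linarith [hy.2])
    · have := hanti.antitone (Nat.succ_le_of_lt hj)
      exact mul_pos (by linarith [hx.1]) (by linarith [hy.1])
  have husm : Summable u :=
    Summable.of_nonneg_of_le (fun k => ((hq _).trans (hu k).1).le) (fun k => (hu k).2.le) hqs
  have hlim1 : Tendsto (fun N => ∑ k ∈ Finset.range N, w N k) atTop (𝓝 (∑' k, u k)) := by
    have := tendsto_tsum_of_dominated_convergence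
      (f := fun N k => if k < N then w N k else 0) (g := u) (𝓕 := atTop) hqs
      (fun k => (hwlim k).congr' ((eventually_gt_atTop k).mono fun N hN => (if_pos hN).symm))
      (Eventually.of_forall fun N k => by
        split_ifs with h
        · rw [Real.norm_of_nonneg ((hq _).trans (hw N k h).1.1).le]
          exact (hw N k h).1.2.le
        · simpa using (hq k).le)
    refine this.congr fun N => ?_
    rw [tsum_eq_sum (s := Finset.range N) fun k hk => if_neg (by simpa using hk)]
    exact Finset.sum_congr rfl fun k hk => if_pos (Finset.mem_range.1 hk)
  have hlim2 := (hqs.hasSum.tendsto_sum_nat.comp (tendsto_add_atTop_nat 1)).sub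
    (hcs.hasSum.tendsto_sum_nat.comp (tendsto_add_atTop_nat 1))
  have := tendsto_nhds_unique ((hlim1.add hzlim).congr hsum) hlim2
  rw [← this, add_sub_cancel_right]
  exact husm.hasSum

/-- The reciprocal squared poles of `x tan x`. -/
noncomputable def tanPole (k : ℕ) : ℝ := 4 / ((2 * (k : ℝ) + 1) ^ 2 * Real.pi ^ 2)

lemma tanPole_eq (k : ℕ) :
    tanPole k = 1 / (Real.pi / 2 + k * Real.pi) ^ 2 := by
  have := Real.pi_pos
  rw [tanPole]
  field_simp
  ring

lemma tanPole_pos (k : ℕ) : 0 < tanPole k := by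
  have := Real.pi_pos
  rw [tanPole]; positivity

lemma strictAnti_tanPole : StrictAnti tanPole := by
  intro a b h
  have := Real.pi_pos
  have : (a : ℝ) < b := by exact_mod_cast h
  simp only [tanPole_eq]
  gcongr

lemma summable_tanPole : Summable tanPole := by
  have h : Summable fun n : ℕ => 1 / (n : ℝ) ^ 2 := Real.summable_one_div_nat_pow.2 one_lt_two
  refine ((h.comp_injective (i := fun k => 2 * k + 1) fun a b hab => by
    simpa using hab).mul_left (4 / Real.pi ^ 2)).congr fun k => ?_
  simp only [tanPole, Function.comp]
  push_cast
  field_simp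

lemma inv_sq_mem_Ioo {t : ℝ} {k : ℕ}
    (h : t ∈ Set.Ioo (Real.pi / 2 + k * Real.pi) (Real.pi / 2 + (k + 1) * Real.pi)) :
    1 / t ^ 2 ∈ Set.Ioo (tanPole (k + 1)) (tanPole k) := by
  have := Real.pi_pos
  have h0 : 0 < Real.pi / 2 + k * Real.pi := by positivity
  have h1 : 0 < t := h0.trans h.1
  rw [tanPole_eq, tanPole_eq]
  push_cast
  have := h.1
  have := h.2
  constructor <;> gcongr

lemma hasSum_real_root {t : ℝ} (ht : 0 < t) (h : Real.cos t + t * Real.sin t = 0) :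
    HasSum (fun j => 2 * tanPole j / (1 / t ^ 2 - tanPole j)) (-1) := by
  refine hasSum_secular_of_root (y := t) (by exact_mod_cast ht.ne') (by exact_mod_cast h) ?_
  have : (t : ℂ) ≠ 0 := by exact_mod_cast ht.ne'
  push_cast
  field_simp

lemma hasSum_imaginary_root {α : ℝ} (hα : 0 < α)
    (h : Real.cosh α = α * Real.sinh α) :
    HasSum (fun j => 2 * tanPole j / (-(1 / α ^ 2) - tanPole j)) (-1) := by
  have h0 : (α : ℂ) ≠ 0 := by exact_mod_cast hα.ne'
  have h' : Complex.cosh α = α * Complex.sinh α := by exact_mod_cast h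
  refine hasSum_secular_of_root (y := α * Complex.I) (mul_ne_zero h0 Complex.I_ne_zero) ?_ ?_
  · rw [Complex.cos_mul_I, Complex.sin_mul_I, h']
    linear_combination (α * Complex.sinh α) * Complex.I_mul_I
  · push_cast
    rw [mul_pow, Complex.I_sq]
    field_simp

lemma exists_real_root (k : ℕ) :
    ∃ t ∈ Set.Ioo (Real.pi / 2 + k * Real.pi) (Real.pi / 2 + (k + 1) * Real.pi),
      Real.cos t + t * Real.sin t = 0 := by
  have hpi := Real.pi_pos
  set g : ℝ → ℝ := fun t => (-1) ^ k * (Real.cos t + t * Real.sin t) with hg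
  have hle : Real.pi / 2 + k * Real.pi ≤ Real.pi / 2 + (k + 1) * Real.pi := by linarith
  have hs : ((-1 : ℝ) ^ k) * (-1) ^ k = 1 := by rw [← mul_pow]; norm_num
  have hval : ∀ m : ℕ, Real.cos (Real.pi / 2 + m * Real.pi) = 0 ∧
      Real.sin (Real.pi / 2 + m * Real.pi) = (-1) ^ m := by
    intro m
    rw [Real.cos_add_nat_mul_pi, Real.sin_add_nat_mul_pi]
    simp
  have h0 : (0 : ℝ) ∈ Set.Ioo (g (Real.pi / 2 + (k + 1) * Real.pi))
      (g (Real.pi / 2 + k * Real.pi)) := by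
    have e1 := hval k
    have e2 := hval (k + 1)
    push_cast at e2
    constructor
    · simp only [hg, e2.1, e2.2, pow_succ]
      have : 0 < Real.pi / 2 + ((k : ℝ) + 1) * Real.pi := by positivity
      linear_combination this + (Real.pi / 2 + ((k : ℝ) + 1) * Real.pi) * -hs
    · simp only [hg, e1.1, e1.2]
      have : 0 < Real.pi / 2 + (k : ℝ) * Real.pi := by positivity
      linear_combination this + (Real.pi / 2 + (k : ℝ) * Real.pi) * -hs
  obtain ⟨t, ht, ht0⟩ := intermediate_value_Ioo' hle (by fun_prop) h0
  exact ⟨t, ht, (mul_eq_zero.1 ht0).resolve_left (by positivity)⟩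

lemma exists_interval_of_root {t : ℝ} (ht : 0 < t)
    (h : Real.cos t + t * Real.sin t = 0) : ∃ k : ℕ,
    t ∈ Set.Ioo (Real.pi / 2 + k * Real.pi) (Real.pi / 2 + (k + 1) * Real.pi) := by
  have hpi := Real.pi_pos
  have hcos : Real.cos t ≠ 0 := by
    intro h0
    have h1 := Real.sin_sq_add_cos_sq t
    rw [h0, zero_add] at h
    rw [(mul_eq_zero.1 h).resolve_left ht.ne', h0] at h1
    norm_num at h1
  have hge : Real.pi / 2 ≤ t := by
    by_contra! hlt
    have h1 := Real.cos_pos_of_mem_Ioo ⟨by linarith, hlt⟩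
    have h2 := Real.sin_pos_of_pos_of_lt_pi ht (by linarith)
    have := mul_pos ht h2
    linarith
  have hn : 0 ≤ (t - Real.pi / 2) / Real.pi := div_nonneg (by linarith) hpi.le
  refine ⟨⌊(t - Real.pi / 2) / Real.pi⌋₊, lt_of_le_of_ne ?_ ?_, ?_⟩
  · have := Nat.floor_le hn
    rw [le_div_iff₀ hpi] at this
    linarith
  · intro he
    apply hcos
    rw [← he, Real.cos_add_nat_mul_pi]
    simp
  · have := Nat.lt_floor_add_one ((t - Real.pi / 2) / Real.pi)
    rw [div_lt_iff₀ hpi] at this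
    linarith

lemma root_unique {k : ℕ} {s t : ℝ}
    (hs : s ∈ Set.Ioo (Real.pi / 2 + k * Real.pi) (Real.pi / 2 + (k + 1) * Real.pi))
    (ht : t ∈ Set.Ioo (Real.pi / 2 + k * Real.pi) (Real.pi / 2 + (k + 1) * Real.pi))
    (hs0 : Real.cos s + s * Real.sin s = 0) (ht0 : Real.cos t + t * Real.sin t = 0) : s ≤ t := by
  have hpi := Real.pi_pos
  have h0 : 0 < Real.pi / 2 + k * Real.pi := by positivity
  have hsp := h0.trans hs.1
  have htp := h0.trans ht.1
  by_contra! hlt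
  refine secular_root_unique (q := tanPole) (c := fun j => 2 * tanPole j) (a := 1 / s ^ 2)
    (b := 1 / t ^ 2) (fun j => mul_pos two_pos (tanPole_pos j)) (fun j => ?_) (by gcongr)
    (hasSum_real_root hsp hs0) (hasSum_real_root htp ht0)
  have hx := inv_sq_mem_Ioo hs
  have hy := inv_sq_mem_Ioo ht
  rcases le_or_gt j k with hj | hj
  · have := strictAnti_tanPole.antitone hj
    exact mul_pos_of_neg_of_neg (by linarith [hx.2]) (by linarith [hy.2])
  · have := strictAnti_tanPole.antitone (Nat.succ_le_of_lt hj)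
    exact mul_pos (by linarith [hx.1]) (by linarith [hy.1])

lemma enumeration_mem_Ioo {X : ℕ → ℝ} (hX_mono : StrictMono X) (hX_pos : ∀ m, 0 < X m)
    (hX_root : ∀ m, Real.cos (X m) + X m * Real.sin (X m) = 0)
    (hX_all : ∀ t : ℝ, 0 < t → Real.cos t + t * Real.sin t = 0 → ∃ m, X m = t) (k : ℕ) :
    X k ∈ Set.Ioo (Real.pi / 2 + k * Real.pi) (Real.pi / 2 + (k + 1) * Real.pi) := by
  have hpi := Real.pi_pos
  choose t ht ht0 using exists_real_root
  have htpos : ∀ k, 0 < t k := fun k => lt_trans (by positivity) (ht k).1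
  have htm : StrictMono t := strictMono_nat_of_lt_succ fun n => by
    have := (ht (n + 1)).1
    push_cast at this
    exact (ht n).2.trans this
  have : X = t := by
    rw [← hX_mono.range_inj htm]
    ext x
    constructor
    · rintro ⟨m, rfl⟩
      obtain ⟨j, hj⟩ := exists_interval_of_root (hX_pos m) (hX_root m)
      exact ⟨j, le_antisymm (root_unique (ht j) hj (ht0 j) (hX_root m))
        (root_unique hj (ht j) (hX_root m) (ht0 j))⟩
    · rintro ⟨m, rfl⟩
      exact hX_all _ (htpos m) (ht0 m)
  rw [this]
  exact ht k

/-- Trace formula: the sum of the reciprocals of the eigenvalues of the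
non-local boundary value problem converges absolutely and equals `0`.
Here `lam 0 = -4α²`, `lam (2m+1) = (2m+1)²π²`, `lam (2m+2) = 4 X m ²`,
where `α` is the unique positive solution of `cosh α = α sinh α` and
`X 0 < X 1 < ⋯` enumerates the positive roots of `cos t + t sin t = 0`. -/
theorem sum_reciprocal_eigenvalues_eq_zero
    (α : ℝ) (hα_pos : 0 < α) (hα_eq : Real.cosh α = α * Real.sinh α)
    (X : ℕ → ℝ) (hX_mono : StrictMono X) (hX_pos : ∀ m, 0 < X m)
    (hX_root : ∀ m, Real.cos (X m) + X m * Real.sin (X m) = 0)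
    (hX_all : ∀ t : ℝ, 0 < t → Real.cos t + t * Real.sin t = 0 → ∃ m, X m = t)
    (lam : ℕ → ℝ) (hlam0 : lam 0 = -4 * α ^ 2)
    (hlam_odd : ∀ m : ℕ, lam (2 * m + 1) = (2 * (m : ℝ) + 1) ^ 2 * Real.pi ^ 2)
    (hlam_even : ∀ m : ℕ, lam (2 * m + 2) = 4 * (X m) ^ 2) :
    Summable (fun n : ℕ => 1 / lam n) ∧ ∑' n : ℕ, 1 / lam n = 0 := by
  have hX : HasSum (fun k => 1 / X k ^ 2) (1 / α ^ 2 - ∑' j, tanPole j) := by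
    have := hasSum_secular_roots tanPole_pos strictAnti_tanPole summable_tanPole
      (c := fun j => 2 * tanPole j) (fun j => mul_pos two_pos (tanPole_pos j))
      (summable_tanPole.mul_left 2) (by linarith [tanPole_pos 0])
      (fun k => inv_sq_mem_Ioo (enumeration_mem_Ioo hX_mono hX_pos hX_root hX_all k))
      (fun k => hasSum_real_root (hX_pos k) (hX_root k))
      (v := -(1 / α ^ 2)) (by simpa using by positivity)
      (hasSum_imaginary_root hα_pos hα_eq)
    rw [tsum_mul_left] at this
    convert this using 1
    ring
  have hodd : HasSum (fun k : ℕ => 1 / lam (2 * k + 1)) (1 / 4 * ∑' j, tanPole j) := by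
    refine (summable_tanPole.hasSum.mul_left (1 / 4)).congr_fun fun k => ?_
    rw [hlam_odd, tanPole]
    ring
  have heven : HasSum (fun k : ℕ => 1 / lam (2 * k + 1 + 1))
      (1 / 4 * (1 / α ^ 2 - ∑' j, tanPole j)) := by
    refine (hX.mul_left (1 / 4)).congr_fun fun k => ?_
    rw [hlam_even]
    ring
  have htail : HasSum (fun n : ℕ => 1 / lam (n + 1)) _ :=
    HasSum.even_add_odd (f := fun n : ℕ => 1 / lam (n + 1)) hodd heven
  have hall := (hasSum_nat_add_iff (f := fun n : ℕ => 1 / lam n) 1).1 htail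
  rw [Finset.sum_range_one, hlam0, show 1 / 4 * ∑' j, tanPole j +
    1 / 4 * (1 / α ^ 2 - ∑' j, tanPole j) + 1 / (-4 * α ^ 2) = 0 by field_simp; ring] at hall
  exact ⟨hall.summable, hall.tsum_eq⟩
end

section
/- Let α be the unique positive real number satisfying cosh α = α·sinh α, let (x_m)_{m≥1} be the strictly increasing enumeration of the positive solutions of cos x + x·sin x = 0, and define λ₀ = −4α², λ_{2m−1} = (2m−1)²π², λ_{2m} = 4x_m² for m ≥ 1. For every integer p ≥ 1, writing S_{2p} = Σ_{m=1}^∞ 1/x_m^{2p}, one has Σ_{n=0}^∞ 1/λ_n^p = (1/4^p)·(S_{2p} + (−1)^p/α^{2p}) + ((4^p − 1)/(2·(2p)!))·|B_{2p}|, where B_{2p} is the (2p)-th Bernoulli number. -/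
/-- Every positive solution of `cos x + x sin x = 0` exceeds `1`. -/
lemma one_lt_of_cos_add_mul_sin_eq_zero {t : ℝ} (ht : 0 < t)
    (h : Real.cos t + t * Real.sin t = 0) : 1 < t := by
  by_contra! h1
  have hc : 0 < Real.cos t := Real.cos_pos_of_le_one (by rw [abs_of_pos ht]; exact h1)
  have hs : 0 < Real.sin t := Real.sin_pos_of_pos_of_le_one ht h1
  have := mul_pos ht hs
  linarith

/-- At a solution of `cos x + x sin x = 0` beyond `1` one has `sin² x ≤ 1/2`. -/
lemma sin_sq_le_half_of_cos_add_mul_sin_eq_zero {t : ℝ} (ht : 1 < t)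
    (h : Real.cos t + t * Real.sin t = 0) : Real.sin t ^ 2 ≤ 1 / 2 := by
  have hc : Real.cos t = -(t * Real.sin t) := by linarith
  have h1 := Real.sin_sq_add_cos_sq t
  rw [hc] at h1
  have h2 : 0 ≤ (t ^ 2 - 1) * Real.sin t ^ 2 := mul_nonneg (by nlinarith) (sq_nonneg _)
  nlinarith

/-- Distinct positive solutions of `cos x + x sin x = 0` are at distance more than `1`. -/
lemma one_lt_sub_of_cos_add_mul_sin_eq_zero {s t : ℝ} (hs : 0 < s) (hst : s < t)
    (h : Real.cos s + s * Real.sin s = 0) (h' : Real.cos t + t * Real.sin t = 0) :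
    1 < t - s := by
  by_contra! hd
  have hd0 : 0 < t - s := sub_pos.mpr hst
  have hs2 := sin_sq_le_half_of_cos_add_mul_sin_eq_zero
    (one_lt_of_cos_add_mul_sin_eq_zero hs h) h
  have ht2 := sin_sq_le_half_of_cos_add_mul_sin_eq_zero
    (one_lt_of_cos_add_mul_sin_eq_zero (hs.trans hst) h') h'
  have key : Real.sin (t - s) = (t - s) * (Real.sin s * Real.sin t) := by
    rw [Real.sin_sub]
    linear_combination Real.sin t * h - Real.sin s * h'
  have hle : Real.sin s * Real.sin t ≤ 1 / 2 := by
    nlinarith [sq_nonneg (Real.sin s - Real.sin t)]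
  have hlow := Real.sin_gt_sub_cube hd0
  have hup : (t - s) * (Real.sin s * Real.sin t) ≤ (t - s) * (1 / 2) :=
    mul_le_mul_of_nonneg_left hle hd0.le
  have hcube : (t - s) ^ 3 ≤ t - s := pow_le_of_le_one hd0.le hd (by norm_num)
  linarith

/-- The reciprocal powers `1 / x_m ^ k`, `k ≥ 2`, of an increasing sequence of positive solutions of
`cos x + x sin x = 0` are summable. -/
lemma summable_one_div_pow_of_cos_add_mul_sin_eq_zero {X : ℕ → ℝ} (hX_mono : StrictMono X)
    (hX_pos : ∀ m, 0 < X m) (hX_root : ∀ m, Real.cos (X m) + X m * Real.sin (X m) = 0)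
    {k : ℕ} (hk : 1 < k) : Summable fun m => 1 / X m ^ k := by
  have hgrow : ∀ m : ℕ, ((m + 1 : ℕ) : ℝ) ≤ X m := by
    intro m
    induction m with
    | zero => simpa using (one_lt_of_cos_add_mul_sin_eq_zero (hX_pos 0) (hX_root 0)).le
    | succ m ih =>
      have := one_lt_sub_of_cos_add_mul_sin_eq_zero (hX_pos m) (hX_mono (Nat.lt_succ_self m))
        (hX_root m) (hX_root (m + 1))
      push_cast at ih ⊢
      linarith
  have hsum : Summable fun m : ℕ => 1 / ((m + 1 : ℕ) : ℝ) ^ k :=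
    (summable_nat_add_iff 1).mpr (Real.summable_one_div_nat_pow.mpr hk)
  refine hsum.of_nonneg_of_le (fun m => by have := hX_pos m; positivity) fun m => ?_
  have := hgrow m
  gcongr

/-- The sum of the reciprocal even powers of the odd multiples of `π`. -/
lemma hasSum_one_div_odd_mul_pi_pow {p : ℕ} (hp : p ≠ 0) :
    HasSum (fun m : ℕ => 1 / ((2 * (m : ℝ) + 1) ^ 2 * Real.pi ^ 2) ^ p)
      (((4 ^ p - 1) / (2 * (Nat.factorial (2 * p)))) * |((bernoulli (2 * p) : ℚ) : ℝ)|) := by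
  have hpi : (Real.pi : ℝ) ≠ 0 := Real.pi_ne_zero
  have hfac : (0 : ℝ) < (Nat.factorial (2 * p) : ℝ) := by positivity
  have h22 : (2 : ℝ) ^ (2 * p - 1) = 4 ^ p / 2 := by
    obtain ⟨q, rfl⟩ := Nat.exists_eq_succ_of_ne_zero hp
    rw [show 2 * q.succ - 1 = 2 * q + 1 by omega, pow_succ, pow_mul, Nat.succ_eq_add_one,
      pow_succ (4 : ℝ)]
    norm_num
    ring
  have hz := hasSum_zeta_nat hp
  set B : ℝ := ((bernoulli (2 * p) : ℚ) : ℝ) with hB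
  have habs : (-1 : ℝ) ^ (p + 1) * B = |B| := by
    have hnn : 0 ≤ (-1 : ℝ) ^ (p + 1) * B := by
      have h0 := hz.nonneg (fun n => by positivity)
      have h1 : (-1 : ℝ) ^ (p + 1) * 2 ^ (2 * p - 1) * Real.pi ^ (2 * p) * B /
          (Nat.factorial (2 * p) : ℝ) = ((-1 : ℝ) ^ (p + 1) * B) *
            (2 ^ (2 * p - 1) * Real.pi ^ (2 * p) / (Nat.factorial (2 * p) : ℝ)) := by ring
      rw [h1] at h0
      exact nonneg_of_mul_nonneg_left h0 (by have := Real.pi_pos; positivity)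
    rw [← abs_of_nonneg hnn, abs_mul, abs_pow, abs_neg, abs_one, one_pow, one_mul]
  set Z : ℝ := (-1 : ℝ) ^ (p + 1) * 2 ^ (2 * p - 1) * Real.pi ^ (2 * p) * B /
    (Nat.factorial (2 * p) : ℝ) with hZ
  have heven : HasSum (fun m : ℕ => 1 / ((2 * m : ℕ) : ℝ) ^ (2 * p)) (1 / 4 ^ p * Z) := by
    refine (hz.mul_left (1 / 4 ^ p)).congr_fun fun m => ?_
    push_cast
    rw [mul_pow, pow_mul (2 : ℝ)]
    norm_num
    ring
  have hodd_summable : Summable fun m : ℕ => 1 / ((2 * m + 1 : ℕ) : ℝ) ^ (2 * p) :=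
    hz.summable.comp_injective (i := fun m : ℕ => 2 * m + 1) fun a b h => by
      simp only at h; omega
  have hodd : HasSum (fun m : ℕ => 1 / ((2 * m + 1 : ℕ) : ℝ) ^ (2 * p)) (Z - 1 / 4 ^ p * Z) := by
    have hu := (heven.even_add_odd (f := fun n : ℕ => 1 / (n : ℝ) ^ (2 * p))
      hodd_summable.hasSum).unique hz
    rw [sub_eq_of_eq_add' hu.symm]
    exact hodd_summable.hasSum
  have hval : (Z - 1 / 4 ^ p * Z) * (1 / Real.pi ^ (2 * p)) =
      (4 ^ p - 1) / (2 * (Nat.factorial (2 * p))) * |B| := by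
    rw [← habs, hZ, h22]
    field_simp
  rw [← hval]
  refine (hodd.mul_right _).congr_fun fun m => ?_
  push_cast
  rw [mul_pow, ← pow_mul, ← pow_mul]
  field_simp


/-- Higher-power trace formula: for every `p ≥ 1`,
`∑_n 1/λ_n^p = 4^{-p}(S_{2p} + (-1)^p/α^{2p}) + (4^p - 1)/(2(2p)!) |B_{2p}|`,
where `S_{2p} = ∑_{m≥1} 1/x_m^{2p}` and `B_{2p}` is the `(2p)`-th Bernoulli
number. Here `lam 0 = -4α²`, `lam (2m+1) = (2m+1)²π²`, `lam (2m+2) = 4 X m ²`. -/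
theorem sum_reciprocal_eigenvalue_powers
    (α : ℝ) (hα_pos : 0 < α) (hα_eq : Real.cosh α = α * Real.sinh α)
    (X : ℕ → ℝ) (hX_mono : StrictMono X) (hX_pos : ∀ m, 0 < X m)
    (hX_root : ∀ m, Real.cos (X m) + X m * Real.sin (X m) = 0)
    (hX_all : ∀ t : ℝ, 0 < t → Real.cos t + t * Real.sin t = 0 → ∃ m, X m = t)
    (lam : ℕ → ℝ) (hlam0 : lam 0 = -4 * α ^ 2)
    (hlam_odd : ∀ m : ℕ, lam (2 * m + 1) = (2 * (m : ℝ) + 1) ^ 2 * Real.pi ^ 2)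
    (hlam_even : ∀ m : ℕ, lam (2 * m + 2) = 4 * (X m) ^ 2)
    (p : ℕ) (hp : 1 ≤ p) :
    ∑' n : ℕ, 1 / (lam n) ^ p =
      (1 / 4 ^ p) * ((∑' m : ℕ, 1 / (X m) ^ (2 * p)) + (-1) ^ p / α ^ (2 * p)) +
        ((4 ^ p - 1) / (2 * (Nat.factorial (2 * p)))) * |((bernoulli (2 * p) : ℚ) : ℝ)| := by
  have hXs : HasSum (fun m => 1 / X m ^ (2 * p)) (∑' m : ℕ, 1 / (X m) ^ (2 * p)) :=
    (summable_one_div_pow_of_cos_add_mul_sin_eq_zero hX_mono hX_pos hX_root (by omega)).hasSum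
  have hodd : HasSum (fun m : ℕ => 1 / lam (2 * m + 1) ^ p)
      (((4 ^ p - 1) / (2 * (Nat.factorial (2 * p)))) * |((bernoulli (2 * p) : ℚ) : ℝ)|) := by
    simp only [hlam_odd]
    exact hasSum_one_div_odd_mul_pi_pow (by omega)
  have heven : HasSum (fun m : ℕ => 1 / lam (2 * m + 1 + 1) ^ p)
      (1 / 4 ^ p * ∑' m : ℕ, 1 / (X m) ^ (2 * p)) := by
    refine (hXs.mul_left (1 / 4 ^ p)).congr_fun fun m => ?_
    rw [hlam_even, mul_pow, ← pow_mul, one_div_mul_one_div]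
  have hzero : 1 / lam 0 ^ p = 1 / 4 ^ p * ((-1) ^ p / α ^ (2 * p)) := by
    have hsign : ((-1 : ℝ) ^ p) * (-1) ^ p = 1 := by rw [← mul_pow]; norm_num
    rw [hlam0, show (-4 * α ^ 2 : ℝ) = -1 * (4 * α ^ 2) by ring, mul_pow, mul_pow, ← pow_mul]
    field_simp
    rw [sq, hsign]
  have htail := hodd.even_add_odd (f := fun n : ℕ => 1 / lam (n + 1) ^ p) heven
  have htot := (hasSum_nat_add_iff (f := fun n : ℕ => 1 / lam n ^ p) 1).mp htail
  rw [htot.tsum_eq, Finset.sum_range_one, hzero]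
  ring
end

section
/- Let α be the unique positive real number satisfying cosh α = α·sinh α and let (x_m)_{m≥1} be the strictly increasing enumeration of the positive solutions of cos x + x·sin x = 0; set S_{2ℓ} = Σ_{m=1}^∞ 1/x_m^{2ℓ} for ℓ ≥ 1. Then for every integer n ≥ 0, Σ_{ℓ=1}^{n+1} [(−1)^{n−ℓ+1}·(2(n−ℓ+1)−1)/(2(n−ℓ+1))!]·(S_{2ℓ} + (−1)^ℓ/α^{2ℓ}) = (−1)^n/(2·(2n)!). -/
open Filter Metric Topology in
/-- A zero-free holomorphic function on a ball has small logarithmic-derivative coefficients. -/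
theorem norm_iteratedDeriv_logDeriv_le {G : ℂ → ℂ} {R M : ℝ} (hR : 0 < R) (hM : 0 < M)
    (hG : DifferentiableOn ℂ G (ball 0 R)) (hne : ∀ z ∈ ball (0 : ℂ) R, G z ≠ 0) (h0 : G 0 = 1)
    (hbd : ∀ z ∈ ball (0 : ℂ) R, ‖G z‖ ≤ Real.exp M) (k : ℕ) :
    ‖iteratedDeriv k (logDeriv G) 0‖ ≤ (k + 1).factorial * (2 * M) / (R / 2) ^ (k + 1) := by
  have hmem : (0 : ℂ) ∈ ball (0 : ℂ) R := mem_ball_self hR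
  have hL : DifferentiableOn ℂ (logDeriv G) (ball 0 R) := (hG.deriv isOpen_ball).div hG hne
  obtain ⟨h, hh0, hh⟩ := hL.isExactOn_ball.with_val_at 0 0
  have hd : DifferentiableOn ℂ h (ball 0 R) :=
    fun z hz ↦ (hh z hz).differentiableAt.differentiableWithinAt
  have hexp : ∀ z ∈ ball (0 : ℂ) R, G z * Complex.exp (-h z) = 1 := by
    have hderiv : ∀ z ∈ ball (0 : ℂ) R,
        HasDerivAt (fun z ↦ G z * Complex.exp (-h z)) 0 z := by
      intro z hz
      have hGz := (hG.differentiableAt (isOpen_ball.mem_nhds hz)).hasDerivAt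
      have hzero : deriv G z * Complex.exp (-h z) +
          G z * (Complex.exp (-h z) * -logDeriv G z) = 0 := by
        rw [logDeriv_apply]
        field_simp [hne z hz]
        ring
      exact hzero ▸ hGz.mul (hh z hz).neg.cexp
    intro z hz
    have hconst := isOpen_ball.is_const_of_deriv_eq_zero (convex_ball (0 : ℂ) R).isPreconnected
      (fun z hz ↦ (hderiv z hz).differentiableAt.differentiableWithinAt)
      (fun z hz ↦ (hderiv z hz).deriv) hz hmem
    simpa [h0, hh0] using hconst
  have hre : Set.MapsTo h (ball 0 R) {z | z.re ≤ M} := by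
    intro z hz
    have hGz : G z = Complex.exp (h z) := by
      have := hexp z hz
      rw [Complex.exp_neg] at this
      exact (mul_inv_eq_one₀ (Complex.exp_ne_zero _)).1 this
    have := hbd z hz
    rw [hGz, Complex.norm_exp] at this
    exact Real.exp_le_exp.1 this
  have hsub : closedBall (0 : ℂ) (R / 2) ⊆ ball 0 R := closedBall_subset_ball (by linarith)
  have hcauchy : ‖iteratedDeriv (k + 1) h 0‖ ≤ (k + 1).factorial * (2 * M) / (R / 2) ^ (k + 1) := by
    refine Complex.norm_iteratedDeriv_le_of_forall_mem_sphere_norm_le (k + 1) (by positivity)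
      (hd.diffContOnCl_ball hsub) ?_
    intro z hz
    have hz' : ‖z‖ = R / 2 := by simpa using hz
    refine (Complex.borelCaratheodory_zero hM hd hre hR
      (hsub (sphere_subset_closedBall hz)) hh0).trans_eq ?_
    rw [hz']
    field_simp
    ring
  have heq : deriv h =ᶠ[𝓝 0] logDeriv G :=
    eventually_of_mem (isOpen_ball.mem_nhds hmem) fun z hz ↦ (hh z hz).deriv
  rwa [iteratedDeriv_succ', heq.iteratedDeriv_eq] at hcauchy

/-- An entire function vanishing on a finite set of nonzero points is divisible by the
corresponding product of linear factors. -/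
theorem exists_differentiable_eq_prod_mul {F : ℂ → ℂ} (hF : Differentiable ℂ F) (S : Finset ℂ)
    (hS : ∀ a ∈ S, F a = 0 ∧ a ≠ 0) :
    ∃ G : ℂ → ℂ, Differentiable ℂ G ∧ ∀ w, F w = (∏ a ∈ S, (1 - w / a)) * G w := by
  classical
  induction S using Finset.induction_on with
  | empty => exact ⟨F, hF, by simp⟩
  | insert a S ha ih =>
    obtain ⟨G, hG, hFG⟩ := ih fun b hb ↦ hS b (Finset.mem_insert_of_mem hb)
    obtain ⟨hFa, ha0⟩ := hS a (Finset.mem_insert_self a S)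
    have hGa : G a = 0 := by
      rw [hFG] at hFa
      refine (mul_eq_zero.1 hFa).resolve_left (Finset.prod_ne_zero_iff.2 fun b hb hab ↦ ?_)
      have hb0 := (hS b (Finset.mem_insert_of_mem hb)).2
      rw [sub_eq_zero, eq_comm, div_eq_one_iff_eq hb0] at hab
      exact ha (hab ▸ hb)
    refine ⟨fun w ↦ -a * dslope G a w, ?_, fun w ↦ ?_⟩
    · have hds : DifferentiableOn ℂ (dslope G a) Set.univ :=
        (Complex.differentiableOn_dslope Filter.univ_mem).2 hG.differentiableOn
      exact (differentiableOn_univ.1 hds).const_mul _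
    · have := sub_smul_dslope G a w
      rw [hGa, sub_zero, smul_eq_mul] at this
      rw [hFG, Finset.prod_insert ha, ← this]
      field_simp
      ring

/-- The Taylor coefficients at the origin of a simple fraction. -/
theorem iteratedDeriv_one_div_sub_zero {a : ℂ} (ha : a ≠ 0) (k : ℕ) :
    iteratedDeriv k (fun w ↦ 1 / (a - w)) 0 = k.factorial * (a ^ (k + 1))⁻¹ := by
  have h := (Complex.one_div_sub_hasFPowerSeriesOnBall_zero ha).hasFPowerSeriesAt
  have := h.eq_formalMultilinearSeries h.analyticAt.hasFPowerSeriesAt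
  have := congrArg (fun p ↦ p.coeff k) this
  simp only [FormalMultilinearSeries.coeff_ofScalars] at this
  rw [this]
  field_simp [Nat.factorial_ne_zero]

open Filter Metric Topology in
/-- The power sum of the inverse zeros in a disc of radius `R` approximates a Taylor coefficient of
the logarithmic derivative, for an entire function with simple zeros and growth `exp (C √‖w‖)`. -/
theorem norm_iteratedDeriv_logDeriv_add_sum_le {F : ℂ → ℂ} {C R : ℝ} (hF : Differentiable ℂ F)
    (h0 : F 0 = 1) (hsimple : ∀ w, F w = 0 → deriv F w ≠ 0) (hC : 0 < C)
    (hbd : ∀ w, ‖F w‖ ≤ Real.exp (C * √‖w‖)) (hR : 0 < R)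
    {S : Finset ℂ} (hS : ∀ w, w ∈ S ↔ F w = 0 ∧ ‖w‖ ≤ R) (k : ℕ) :
    ‖iteratedDeriv k (logDeriv F) 0 + k.factorial * ∑ a ∈ S, (a ^ (k + 1))⁻¹‖ ≤
      (k + 1).factorial * (2 * (C * √(2 * R))) / (R / 2) ^ (k + 1) := by
  have hS0 : ∀ a ∈ S, a ≠ 0 := by
    rintro a ha rfl
    exact one_ne_zero (h0.symm.trans ((hS 0).1 ha).1)
  obtain ⟨G, hG, hFG⟩ := exists_differentiable_eq_prod_mul hF S
    fun a ha ↦ ⟨((hS a).1 ha).1, hS0 a ha⟩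
  have hG0 : G 0 = 1 := by simpa [h0] using (hFG 0).symm
  have hGne : ∀ z ∈ ball (0 : ℂ) R, G z ≠ 0 := by
    intro z hz hGz
    have hFz : F z = 0 := by rw [hFG, hGz, mul_zero]
    have hzS : z ∈ S := (hS z).2 ⟨hFz, (mem_ball_zero_iff.1 hz).le⟩
    have hPz : ∏ a ∈ S, (1 - z / a) = 0 :=
      Finset.prod_eq_zero hzS (by rw [div_self (hS0 z hzS), sub_self])
    refine hsimple z hFz ?_
    have hP : DifferentiableAt ℂ (fun w ↦ ∏ a ∈ S, (1 - w / a)) z := by fun_prop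
    have := hP.hasDerivAt.mul (hG z).hasDerivAt
    rw [hGz, hPz, mul_zero, zero_mul, add_zero] at this
    rw [show F = (fun w ↦ ∏ a ∈ S, (1 - w / a)) * G from funext hFG]
    exact this.deriv
  have hGbd : ∀ z ∈ ball (0 : ℂ) R, ‖G z‖ ≤ Real.exp (C * √(2 * R)) := by
    intro z hz
    have h2R : 2 * R ≠ 0 := by positivity
    refine Complex.norm_le_of_forall_mem_frontier_norm_le
      (isBounded_ball (x := (0 : ℂ)) (r := 2 * R)) hG.diffContOnCl (fun w hw ↦ ?_) (subset_closure (ball_subset_ball (by linarith) hz))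
    rw [frontier_ball _ h2R, mem_sphere_zero_iff_norm] at hw
    have hP1 : 1 ≤ ‖∏ a ∈ S, (1 - w / a)‖ := by
      rw [norm_prod]
      refine Finset.one_le_prod fun a ha ↦ ?_
      have haR := ((hS a).1 ha).2
      have hapos : 0 < ‖a‖ := norm_pos_iff.2 (hS0 a ha)
      have h1 : ‖w / a‖ - ‖(1 : ℂ)‖ ≤ ‖1 - w / a‖ := by
        rw [norm_sub_rev]; exact norm_sub_norm_le _ _
      have h2 : 2 ≤ ‖w / a‖ := by
        rw [norm_div, hw, le_div_iff₀ hapos]; linarith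
      rw [norm_one] at h1
      linarith
    calc ‖G w‖ ≤ ‖∏ a ∈ S, (1 - w / a)‖ * ‖G w‖ := le_mul_of_one_le_left (norm_nonneg _) hP1
      _ = ‖F w‖ := by rw [hFG, norm_mul]
      _ ≤ _ := by simpa [hw] using hbd w
  have hev : logDeriv F =ᶠ[𝓝 0] fun w ↦ -∑ a ∈ S, 1 / (a - w) + logDeriv G w := by
    have hF0 : ∀ᶠ w in 𝓝 (0 : ℂ), F w ≠ 0 :=
      hF.continuous.continuousAt.eventually_ne (by simp [h0])
    filter_upwards [hF0] with w hw
    rw [hFG] at hw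
    have hPw := left_ne_zero_of_mul hw
    have hfac := Finset.prod_ne_zero_iff.1 hPw
    rw [show F = fun w ↦ (∏ a ∈ S, (1 - w / a)) * G w from funext hFG,
      logDeriv_mul w hPw (right_ne_zero_of_mul hw) (by fun_prop) (hG w),
      logDeriv_prod hfac (by fun_prop), ← Finset.sum_neg_distrib]
    congr 1
    refine Finset.sum_congr rfl fun a ha ↦ ?_
    have ha0 := hS0 a ha
    have haw : a - w ≠ 0 := fun h ↦ hfac a ha (by rw [← sub_eq_zero.1 h, div_self ha0, sub_self])
    rw [logDeriv_apply]
    simp only [deriv_const_sub, deriv_div_const, deriv_id'']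
    field_simp
  have hsum : iteratedDeriv k (logDeriv F) 0 + k.factorial * ∑ a ∈ S, (a ^ (k + 1))⁻¹ =
      iteratedDeriv k (logDeriv G) 0 := by
    have hana : ∀ a ∈ S, AnalyticAt ℂ (fun w ↦ 1 / (a - w)) 0 := fun a ha ↦
      (Complex.one_div_sub_hasFPowerSeriesOnBall_zero (hS0 a ha)).analyticAt
    have hGa : AnalyticAt ℂ G 0 := hG.analyticAt 0
    have hlG : AnalyticAt ℂ (logDeriv G) 0 := hGa.deriv.div hGa (by simp [hG0])
    have hsa : AnalyticAt ℂ (fun w ↦ ∑ a ∈ S, 1 / (a - w)) 0 :=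
      Finset.analyticAt_fun_sum S hana
    rw [hev.iteratedDeriv_eq, iteratedDeriv_fun_add hsa.fun_neg.contDiffAt hlG.contDiffAt,
      iteratedDeriv_fun_neg, iteratedDeriv_fun_sum fun a ha ↦ (hana a ha).contDiffAt,
      Finset.mul_sum, Finset.sum_congr rfl fun a ha ↦ iteratedDeriv_one_div_sub_zero (hS0 a ha) k]
    ring
  rw [hsum]
  exact norm_iteratedDeriv_logDeriv_le hR (by positivity) hG.differentiableOn hGne hG0 hGbd k

/-- Newton's identities for the Taylor coefficients of a function and its logarithmic
derivative. -/
theorem iteratedDeriv_succ_eq_sum_logDeriv {F : ℂ → ℂ} (hF : AnalyticAt ℂ F 0) (h0 : F 0 ≠ 0)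
    (n : ℕ) : iteratedDeriv (n + 1) F 0 = ∑ i ∈ Finset.range (n + 1),
      n.choose i * iteratedDeriv i F 0 * iteratedDeriv (n - i) (logDeriv F) 0 := by
  have hL : AnalyticAt ℂ (logDeriv F) 0 := hF.deriv.div hF h0
  rw [← iteratedDeriv_mul hF.contDiffAt hL.contDiffAt, iteratedDeriv_succ']
  refine Filter.EventuallyEq.iteratedDeriv_eq n ?_
  filter_upwards [hF.continuousAt.eventually_ne h0] with w hw
  simp [logDeriv_apply, mul_div_cancel₀, hw]

open Filter Metric Topology in
/-- The power sums of the inverse zeros of an entire function of order at most one half with simple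
zeros. -/
theorem tendsto_sum_inv_pow_zeros {F : ℂ → ℂ} {C : ℝ} (hF : Differentiable ℂ F)
    (h0 : F 0 = 1) (hsimple : ∀ w, F w = 0 → deriv F w ≠ 0) (hC : 0 < C)
    (hbd : ∀ w, ‖F w‖ ≤ Real.exp (C * √‖w‖)) {r : ℕ → ℝ} (hr : Tendsto r atTop atTop)
    {S : ℕ → Finset ℂ} (hS : ∀ᶠ N in atTop, ∀ w, w ∈ S N ↔ F w = 0 ∧ ‖w‖ ≤ r N) (k : ℕ) :
    Tendsto (fun N ↦ ∑ a ∈ S N, (a ^ (k + 1))⁻¹) atTop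
      (𝓝 (-(iteratedDeriv k (logDeriv F) 0 / k.factorial))) := by
  have hlim : Tendsto (fun R : ℝ ↦ (k + 1).factorial * (2 * (C * √(2 * R))) / (R / 2) ^ (k + 1))
      atTop (𝓝 0) := by
    set K : ℝ := (k + 1).factorial * (2 * C) with hK
    have hK0 : 0 < K := by positivity
    have hsq : Tendsto (fun R : ℝ ↦ K * 4 / √(2 * R)) atTop (𝓝 0) :=
      (Real.tendsto_sqrt_atTop.comp (tendsto_id.const_mul_atTop two_pos)).const_div_atTop _
    refine squeeze_zero' ?_ ?_ hsq
    · filter_upwards [eventually_ge_atTop 0] with R hR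
      positivity
    · filter_upwards [eventually_ge_atTop 2] with R hR
      have hs : 0 < √(2 * R) := Real.sqrt_pos.2 (by linarith)
      have hpow : R / 2 ≤ (R / 2) ^ (k + 1) := le_self_pow₀ (by linarith) k.succ_ne_zero
      have hss : R / 2 = √(2 * R) * √(2 * R) / 4 := by
        rw [Real.mul_self_sqrt (by linarith)]; ring
      calc (k + 1).factorial * (2 * (C * √(2 * R))) / (R / 2) ^ (k + 1)
          = K * √(2 * R) / (R / 2) ^ (k + 1) := by rw [hK]; ring
        _ ≤ K * √(2 * R) / (R / 2) := by gcongr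
        _ = K * 4 / √(2 * R) := by
          rw [hss]
          field_simp
  have hz : Tendsto (fun N ↦ iteratedDeriv k (logDeriv F) 0 +
      k.factorial * ∑ a ∈ S N, (a ^ (k + 1))⁻¹) atTop (𝓝 0) := by
    refine squeeze_zero_norm' ?_ (hlim.comp hr)
    filter_upwards [hS, hr.eventually_gt_atTop 0] with N hN hpos
    exact norm_iteratedDeriv_logDeriv_add_sum_le hF h0 hsimple hC hbd hpos hN k
  have := (hz.sub_const (iteratedDeriv k (logDeriv F) 0)).div_const (k.factorial : ℂ)
  have hk : (k.factorial : ℂ) ≠ 0 := by exact_mod_cast k.factorial_ne_zero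
  convert this using 1
  · ext N
    field_simp
    ring
  · congr 1
    ring

/-- A complex function represented everywhere by a power series is entire, and the series gives
its Taylor coefficients. -/
theorem differentiable_and_iteratedDeriv_of_hasSum {F : ℂ → ℂ} {c : ℕ → ℂ}
    (h : ∀ w, HasSum (fun k ↦ c k * w ^ k) (F w)) :
    Differentiable ℂ F ∧ ∀ k, iteratedDeriv k F 0 = k.factorial * c k := by
  have hrad : (FormalMultilinearSeries.ofScalars ℂ c).radius = ⊤ := by
    refine ENNReal.eq_top_of_forall_nnreal_le fun r ↦ ?_
    refine FormalMultilinearSeries.le_radius_of_tendsto (l := 0) _ ?_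
    simpa using (h (r : ℝ)).summable.tendsto_atTop_zero.norm
  have hF : HasFPowerSeriesOnBall F (FormalMultilinearSeries.ofScalars ℂ c) 0 ⊤ := by
    refine ⟨hrad.ge, by simp, fun {y} _ ↦ ?_⟩
    simpa [FormalMultilinearSeries.ofScalars_apply_eq, mul_comm] using h y
  refine ⟨fun w ↦ (hF.analyticAt_of_mem (by simp)).differentiableAt, fun k ↦ ?_⟩
  have := hF.hasFPowerSeriesAt.eq_formalMultilinearSeries hF.analyticAt.hasFPowerSeriesAt
  have := congrArg (fun p ↦ p.coeff k) this
  simp only [FormalMultilinearSeries.coeff_ofScalars] at this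
  rw [this]
  field_simp [Nat.factorial_ne_zero]

/-- The Taylor series of `cos z + z sin z`, in powers of `z ^ 2`. -/
theorem hasSum_cos_add_mul_sin (z : ℂ) :
    HasSum (fun k : ℕ ↦ (-1 : ℂ) ^ k * (1 - 2 * k) / (2 * k).factorial * (z ^ 2) ^ k)
      (Complex.cos z + z * Complex.sin z) := by
  have hsin : HasSum (fun k : ℕ ↦ (-1 : ℂ) ^ k * (-2 * k) / (2 * k).factorial * (z ^ 2) ^ k)
      (z * Complex.sin z) := by
    rw [← hasSum_nat_add_iff' 1]
    simp only [Finset.sum_range_one, Nat.cast_zero, mul_zero, zero_div, zero_mul, sub_zero]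
    convert! (Complex.hasSum_sin z).mul_left z using 2 with k
    rw [show 2 * (k + 1) = 2 * k + 1 + 1 by ring, Nat.factorial_succ (2 * k + 1)]
    have h1 : ((2 * k + 1).factorial : ℂ) ≠ 0 := by exact_mod_cast Nat.factorial_ne_zero _
    have h2 : (k : ℂ) + 1 ≠ 0 := by exact_mod_cast k.succ_ne_zero
    have h3 : ((2 * k + 1 + 1 : ℕ) : ℂ) = 2 * (k + 1) := by push_cast; ring
    push_cast [h3]
    rw [← pow_mul]
    field_simp
    ring
  convert! (Complex.hasSum_cos z).add hsin using 2 with k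
  rw [← pow_mul]
  ring

theorem norm_cos_add_mul_sin_le (z : ℂ) :
    ‖Complex.cos z + z * Complex.sin z‖ ≤ Real.exp (2 * ‖z‖) := by
  have hI : ‖z * Complex.I‖ = ‖z‖ := by simp
  have h1 : ‖Complex.exp (z * Complex.I)‖ ≤ Real.exp ‖z‖ := by
    simpa [hI] using Complex.norm_exp_le_exp_norm (z * Complex.I)
  have h2 : ‖Complex.exp (-z * Complex.I)‖ ≤ Real.exp ‖z‖ := by
    simpa using Complex.norm_exp_le_exp_norm (-z * Complex.I)
  have hcos : ‖Complex.cos z‖ ≤ Real.exp ‖z‖ := by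
    rw [Complex.cos, norm_div, Complex.norm_ofNat]
    linarith [norm_add_le (Complex.exp (z * Complex.I)) (Complex.exp (-z * Complex.I))]
  have hsin : ‖Complex.sin z‖ ≤ Real.exp ‖z‖ := by
    rw [Complex.sin, norm_div, Complex.norm_ofNat, norm_mul, Complex.norm_I, mul_one]
    linarith [norm_sub_le (Complex.exp (-z * Complex.I)) (Complex.exp (z * Complex.I))]
  calc ‖Complex.cos z + z * Complex.sin z‖ ≤ ‖Complex.cos z‖ + ‖z‖ * ‖Complex.sin z‖ := by
        rw [← norm_mul]; exact norm_add_le _ _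
    _ ≤ Real.exp ‖z‖ + ‖z‖ * Real.exp ‖z‖ := by gcongr
    _ = (‖z‖ + 1) * Real.exp ‖z‖ := by ring
    _ ≤ Real.exp ‖z‖ * Real.exp ‖z‖ := by gcongr; exact Real.add_one_le_exp _
    _ = Real.exp (2 * ‖z‖) := by rw [← Real.exp_add, two_mul]

/-- The complex zeros of `cos z + z sin z` are real or purely imaginary. -/
theorem re_eq_zero_or_im_eq_zero_of_cos_add_mul_sin_eq_zero {z : ℂ}
    (hz : Complex.cos z + z * Complex.sin z = 0) : z.re = 0 ∨ z.im = 0 := by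
  by_contra! hne
  obtain ⟨ha, hb⟩ := hne
  set a := z.re
  set b := z.im
  have hzab : z = a + b * Complex.I := (Complex.re_add_im z).symm
  rw [hzab, Complex.cos_add_mul_I, Complex.sin_add_mul_I] at hz
  simp only [← Complex.ofReal_cos, ← Complex.ofReal_sin, ← Complex.ofReal_cosh,
    ← Complex.ofReal_sinh] at hz
  have h1 := congrArg Complex.re hz
  have h2 := congrArg Complex.im hz
  simp [-Complex.ofReal_cos, -Complex.ofReal_sin, -Complex.ofReal_cosh,
    -Complex.ofReal_sinh] at h1 h2
  have key : a * (Real.cosh b * Real.sinh b) = -(b * (Real.sin a * Real.cos a)) := by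
    linear_combination Real.sin a * Real.sinh b * h1 + Real.cos a * Real.cosh b * h2 -
      a * Real.cosh b * Real.sinh b * Real.sin_sq_add_cos_sq a -
      b * Real.sin a * Real.cos a * Real.cosh_sq_sub_sinh_sq b
  have habs := congrArg abs key
  rw [abs_neg, abs_mul, abs_mul, abs_mul, abs_mul, Real.abs_sinh] at habs
  have hsin : |Real.sin a| ≤ |a| := Real.abs_sin_le_abs
  have hcos : |Real.cos a| ≤ 1 := Real.abs_cos_le_one a
  have hsinh : |b| < Real.sinh |b| := Real.self_lt_sinh_iff.2 (abs_pos.2 hb)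
  have hcosh : 1 ≤ |Real.cosh b| := by
    rw [abs_of_pos (Real.cosh_pos b)]; exact Real.one_le_cosh b
  have hapos := abs_pos.2 ha
  have hl : |a| * |b| < |a| * (|Real.cosh b| * Real.sinh |b|) := by
    gcongr
    nlinarith [abs_nonneg b]
  have hr : |b| * (|Real.sin a| * |Real.cos a|) ≤ |b| * |a| := by
    gcongr
    nlinarith [abs_nonneg (Real.sin a)]
  linarith

/-- The positive solution of `cosh t = t sinh t` is unique. -/
theorem cosh_eq_mul_sinh_unique {s t : ℝ} (hs : 0 < s) (ht : 0 < t)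
    (hs' : Real.cosh s = s * Real.sinh s) (ht' : Real.cosh t = t * Real.sinh t) : s = t := by
  have hmul : 0 < Real.sinh s * Real.sinh t :=
    mul_pos (Real.sinh_pos_iff.2 hs) (Real.sinh_pos_iff.2 ht)
  have hsub := Real.sinh_sub t s
  rw [hs', ht'] at hsub
  have heq : Real.sinh (t - s) = -(t - s) * (Real.sinh s * Real.sinh t) := by
    rw [hsub]; ring
  rcases lt_trichotomy s t with h | h | h
  · have := Real.sinh_pos_iff.2 (sub_pos.2 h)
    nlinarith [mul_pos (sub_pos.2 h) hmul]
  · exact h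
  · have := Real.sinh_neg_iff.2 (sub_neg.2 h)
    nlinarith [mul_pos (sub_pos.2 h) hmul]

/-- In the variable `w = z ^ 2`, `cos z + z sin z` is an entire function with simple zeros. -/
theorem exists_entire_sq_eq_cos_add_mul_sin :
    ∃ F : ℂ → ℂ, Differentiable ℂ F ∧ (∀ z, F (z ^ 2) = Complex.cos z + z * Complex.sin z) ∧
      (∀ k, iteratedDeriv k F 0 =
        k.factorial * ((-1) ^ k * (1 - 2 * k) / (2 * k).factorial)) ∧
      ∀ w, F w = 0 → deriv F w ≠ 0 := by
  set F : ℂ → ℂ := fun w ↦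
    ∑' k : ℕ, (-1 : ℂ) ^ k * (1 - 2 * k) / (2 * k).factorial * w ^ k
  have hFsq : ∀ z, F (z ^ 2) = Complex.cos z + z * Complex.sin z :=
    fun z ↦ (hasSum_cos_add_mul_sin z).tsum_eq
  have hsum : ∀ w, HasSum (fun k : ℕ ↦
      (-1 : ℂ) ^ k * (1 - 2 * k) / (2 * k).factorial * w ^ k) (F w) := by
    intro w
    obtain ⟨z, rfl⟩ := IsAlgClosed.exists_pow_nat_eq w two_pos
    exact (hasSum_cos_add_mul_sin z).summable.hasSum
  obtain ⟨hF, hcoeff⟩ := differentiable_and_iteratedDeriv_of_hasSum hsum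
  refine ⟨F, hF, hFsq, hcoeff, fun w hw hdw ↦ ?_⟩
  obtain ⟨z, rfl⟩ := IsAlgClosed.exists_pow_nat_eq w two_pos
  have hchain : HasDerivAt (fun z ↦ F (z ^ 2)) (deriv F (z ^ 2) * (2 * z)) z := by
    have := (hF (z ^ 2)).hasDerivAt.comp z (hasDerivAt_pow 2 z)
    simpa using! this
  rw [funext hFsq, hdw, zero_mul] at hchain
  have hdirect := (Complex.hasDerivAt_cos z).add
    ((hasDerivAt_id z).mul (Complex.hasDerivAt_sin z))
  have hcos : z * Complex.cos z = 0 := by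
    have := hchain.unique hdirect
    simp only [id_eq] at this
    linear_combination -this
  rw [hFsq] at hw
  rcases mul_eq_zero.1 hcos with h | h
  · simp [h] at hw
  · rw [h, zero_add] at hw
    rcases mul_eq_zero.1 hw with h' | h'
    · simp [h'] at h
    · simpa [h, h'] using Complex.sin_sq_add_cos_sq z

/-- The zeros of `cos z + z sin z` in the variable `z ^ 2`. -/
theorem cos_add_mul_sin_eq_zero_iff {α : ℝ} (hα_pos : 0 < α)
    (hα_eq : Real.cosh α = α * Real.sinh α) (z : ℂ) :
    Complex.cos z + z * Complex.sin z = 0 ↔ z ^ 2 = -(α : ℂ) ^ 2 ∨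
      ∃ t : ℝ, 0 < t ∧ Real.cos t + t * Real.sin t = 0 ∧ z ^ 2 = (t : ℂ) ^ 2 := by
  constructor
  · intro hz
    rcases re_eq_zero_or_im_eq_zero_of_cos_add_mul_sin_eq_zero hz with h | h
    · left
      have hzb : z = z.im * Complex.I := by
        conv_lhs => rw [← Complex.re_add_im z, h]
        simp
      have hb : Real.cosh z.im = z.im * Real.sinh z.im := by
        rw [hzb, Complex.cos_mul_I, Complex.sin_mul_I] at hz
        have := congrArg Complex.re hz
        simp [← Complex.ofReal_cosh, ← Complex.ofReal_sinh] at this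
        linarith
      have hb0 : z.im ≠ 0 := by
        intro h0
        simp [h0] at hb
      have : |z.im| = α := by
        refine cosh_eq_mul_sinh_unique (abs_pos.2 hb0) hα_pos ?_ hα_eq
        rcases abs_choice z.im with h | h <;> rw [h] <;> simpa using hb
      rw [hzb, mul_pow, Complex.I_sq, ← this, ← Complex.ofReal_pow, ← Complex.ofReal_pow, sq_abs]
      ring
    · right
      have hza : z = z.re := by
        conv_lhs => rw [← Complex.re_add_im z, h]
        simp
      have ha : Real.cos z.re + z.re * Real.sin z.re = 0 := by
        rw [hza] at hz
        exact_mod_cast hz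
      have ha0 : z.re ≠ 0 := by
        intro h0
        simp [h0] at ha
      refine ⟨|z.re|, abs_pos.2 ha0, ?_, ?_⟩
      · rcases abs_choice z.re with h | h <;> rw [h] <;> simpa using ha
      · rw [← Complex.ofReal_pow, sq_abs, Complex.ofReal_pow, ← hza]
  · rintro (h | ⟨t, -, ht, h⟩)
    · have hsq : z ^ 2 = (α * Complex.I) ^ 2 := by rw [h, mul_pow, Complex.I_sq]; ring
      have hα : Complex.cos (α * Complex.I) + α * Complex.I * Complex.sin (α * Complex.I) = 0 := by
        rw [Complex.cos_mul_I, Complex.sin_mul_I, ← Complex.ofReal_cosh, hα_eq]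
        push_cast
        linear_combination (α : ℂ) * Complex.sinh α * Complex.I_sq
      rcases sq_eq_sq_iff_eq_or_eq_neg.1 hsq with rfl | rfl <;> simpa using hα
    · have ht' : Complex.cos t + t * Complex.sin t = 0 := by exact_mod_cast ht
      rcases sq_eq_sq_iff_eq_or_eq_neg.1 h with rfl | rfl <;> simpa using ht'

/-- An entire function that is not identically zero has finitely many zeros in every disc. -/
theorem finite_zeros_inter_closedBall {F : ℂ → ℂ} (hF : Differentiable ℂ F) {x : ℂ} (hx : F x ≠ 0)
    (R : ℝ) : {w | F w = 0 ∧ ‖w‖ ≤ R}.Finite := by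
  have hcod : F ⁻¹' {0}ᶜ ∈ Filter.codiscrete ℂ :=
    AnalyticOnNhd.preimage_zero_mem_codiscrete (fun z _ ↦ hF.analyticAt z) hx
  have := (isCompact_closedBall (0 : ℂ) R).finite_sdiff_of_mem_codiscreteWithin
    (Filter.codiscreteWithin_mono (Set.subset_univ _) hcod)
  refine this.subset fun w hw ↦ ⟨by simpa using hw.2, by simpa using hw.1⟩

open Filter Topology in
/-- A strictly increasing sequence of positive numbers whose squares are zeros of an entire function
tends to infinity. -/
theorem tendsto_atTop_of_sq_zeros {F : ℂ → ℂ} (hF : Differentiable ℂ F) {x : ℂ} (hx : F x ≠ 0)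
    {X : ℕ → ℝ} (hX_mono : StrictMono X) (hX_pos : ∀ m, 0 < X m)
    (hX : ∀ m, F ((X m : ℂ) ^ 2) = 0) : Tendsto X atTop atTop := by
  refine tendsto_atTop_atTop_of_monotone hX_mono.monotone fun B ↦ ?_
  by_contra! hB
  have hinj : Function.Injective fun m ↦ (X m : ℂ) ^ 2 := by
    intro m n hmn
    have : X m ^ 2 = X n ^ 2 := by exact_mod_cast (show (X m : ℂ) ^ 2 = (X n : ℂ) ^ 2 from hmn)
    exact hX_mono.injective ((sq_eq_sq₀ (hX_pos m).le (hX_pos n).le).1 this)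
  refine Set.infinite_range_of_injective hinj
    ((finite_zeros_inter_closedBall hF hx (B ^ 2)).subset ?_)
  rintro _ ⟨m, rfl⟩
  refine ⟨hX m, ?_⟩
  rw [norm_pow, Complex.norm_real, Real.norm_of_nonneg (hX_pos m).le]
  exact pow_le_pow_left₀ (hX_pos m).le (hB m).le 2

open Filter Topology in
/-- The power sums of the inverse squared zeros of `cos z + z sin z`, as Taylor coefficients of a
logarithmic derivative. -/
theorem tsum_add_eq_neg_iteratedDeriv_logDeriv {F : ℂ → ℂ} (hF : Differentiable ℂ F)
    (hFsq : ∀ z, F (z ^ 2) = Complex.cos z + z * Complex.sin z)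
    (hsimple : ∀ w, F w = 0 → deriv F w ≠ 0)
    {α : ℝ} (hα_pos : 0 < α) (hα_eq : Real.cosh α = α * Real.sinh α)
    {X : ℕ → ℝ} (hX_mono : StrictMono X) (hX_pos : ∀ m, 0 < X m)
    (hX_root : ∀ m, Real.cos (X m) + X m * Real.sin (X m) = 0)
    (hX_all : ∀ t : ℝ, 0 < t → Real.cos t + t * Real.sin t = 0 → ∃ m, X m = t) (k : ℕ) :
    (((∑' m : ℕ, 1 / (X m) ^ (2 * (k + 1))) + (-1) ^ (k + 1) / α ^ (2 * (k + 1)) : ℝ) : ℂ) =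
      -(iteratedDeriv k (logDeriv F) 0 / k.factorial) := by
  have hzero : ∀ w, F w = 0 ↔ w = -(α : ℂ) ^ 2 ∨ ∃ m, w = (X m : ℂ) ^ 2 := by
    intro w
    obtain ⟨z, rfl⟩ := IsAlgClosed.exists_pow_nat_eq w two_pos
    rw [hFsq, cos_add_mul_sin_eq_zero_iff hα_pos hα_eq]
    refine or_congr_right ⟨?_, ?_⟩
    · rintro ⟨t, ht, hroot, hzt⟩
      obtain ⟨m, rfl⟩ := hX_all t ht hroot
      exact ⟨m, hzt⟩
    · rintro ⟨m, hm⟩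
      exact ⟨X m, hX_pos m, hX_root m, hm⟩
  have h0 : F 0 = 1 := by simpa using hFsq 0
  have hbd : ∀ w, ‖F w‖ ≤ Real.exp (2 * √‖w‖) := by
    intro w
    obtain ⟨z, rfl⟩ := IsAlgClosed.exists_pow_nat_eq w two_pos
    rw [hFsq, norm_pow, Real.sqrt_sq (norm_nonneg z)]
    exact norm_cos_add_mul_sin_le z
  have hX_top : Tendsto X atTop atTop := tendsto_atTop_of_sq_zeros hF (x := 0) (by simp [h0])
    hX_mono hX_pos fun m ↦ (hzero _).2 (.inr ⟨m, rfl⟩)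
  have hnorm : ∀ t : ℝ, ‖(t : ℂ) ^ 2‖ = t ^ 2 := fun t ↦ by
    rw [norm_pow, Complex.norm_real, Real.norm_eq_abs, sq_abs]
  have hS : ∀ᶠ N in atTop, ∀ w,
      w ∈ insert (-(α : ℂ) ^ 2) ((Finset.range (N + 1)).image fun m ↦ (X m : ℂ) ^ 2) ↔
        F w = 0 ∧ ‖w‖ ≤ X N ^ 2 := by
    filter_upwards [hX_top.eventually_ge_atTop α] with N hN w
    rw [hzero, Finset.mem_insert, Finset.mem_image]
    constructor
    · rintro (rfl | ⟨m, hm, rfl⟩)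
      · exact ⟨.inl rfl, by rw [norm_neg, hnorm]; gcongr⟩
      · have hmN := hX_mono.monotone (Nat.lt_succ_iff.1 (Finset.mem_range.1 hm))
        exact ⟨.inr ⟨m, rfl⟩, by rw [hnorm]; exact pow_le_pow_left₀ (hX_pos m).le hmN 2⟩
    · rintro ⟨rfl | ⟨m, rfl⟩, hle⟩
      · exact .inl rfl
      · rw [hnorm, sq_le_sq₀ (hX_pos m).le (hX_pos N).le, hX_mono.le_iff_le] at hle
        exact .inr ⟨m, Finset.mem_range.2 (Nat.lt_succ_iff.2 hle), rfl⟩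
  have hlim := tendsto_sum_inv_pow_zeros hF h0 hsimple two_pos hbd
    ((tendsto_pow_atTop two_ne_zero).comp hX_top) hS k
  have hsumS : ∀ N : ℕ,
      ∑ a ∈ insert (-(α : ℂ) ^ 2) ((Finset.range (N + 1)).image fun m ↦ (X m : ℂ) ^ 2),
        (a ^ (k + 1))⁻¹ =
      (((-1) ^ (k + 1) / α ^ (2 * (k + 1)) +
        ∑ m ∈ Finset.range (N + 1), 1 / (X m) ^ (2 * (k + 1)) : ℝ) : ℂ) := by
    intro N
    rw [Finset.sum_insert, Finset.sum_image]
    · push_cast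
      congr 1
      · rw [neg_pow, ← pow_mul, mul_inv, ← inv_pow, inv_neg_one, div_eq_mul_inv]
      · exact Finset.sum_congr rfl fun m _ ↦ by rw [← pow_mul, one_div]
    · intro m _ n _ hmn
      have : X m ^ 2 = X n ^ 2 := by exact_mod_cast (show (X m : ℂ) ^ 2 = (X n : ℂ) ^ 2 from hmn)
      exact hX_mono.injective ((sq_eq_sq₀ (hX_pos m).le (hX_pos n).le).1 this)
    · rw [Finset.mem_image]
      rintro ⟨m, -, hm⟩
      have : X m ^ 2 = -α ^ 2 := by exact_mod_cast hm
      nlinarith [hX_pos m]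
  simp only [hsumS] at hlim
  set L := -(iteratedDeriv k (logDeriv F) 0 / k.factorial)
  have hre := (Complex.continuous_re.tendsto L).comp hlim
  have him := (Complex.continuous_im.tendsto L).comp hlim
  simp only [Function.comp_def, Complex.ofReal_re, Complex.ofReal_im] at hre him
  have hL : L = (L.re : ℂ) :=
    Complex.ext rfl (by simpa using (tendsto_nhds_unique him tendsto_const_nhds))
  have hpartial : Tendsto (fun N ↦ ∑ m ∈ Finset.range N, 1 / (X m) ^ (2 * (k + 1))) atTop
      (𝓝 (L.re - (-1) ^ (k + 1) / α ^ (2 * (k + 1)))) := by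
    rw [← tendsto_add_atTop_iff_nat 1]
    simpa using hre.sub_const ((-1) ^ (k + 1) / α ^ (2 * (k + 1)))
  have hnonneg : ∀ m, 0 ≤ 1 / (X m) ^ (2 * (k + 1)) := fun m ↦ by
    have := hX_pos m
    positivity
  rw [((hasSum_iff_tendsto_nat_of_nonneg hnonneg _).2 hpartial).tsum_eq, sub_add_cancel, ← hL]

/-- Recursion formula for the power sums `S_{2ℓ} = ∑_{m≥1} 1/x_m^{2ℓ}`:
for every `n ≥ 0`,
`∑_{ℓ=1}^{n+1} (-1)^{n-ℓ+1} (2(n-ℓ+1)-1)/(2(n-ℓ+1))! (S_{2ℓ} + (-1)^ℓ/α^{2ℓ})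
  = (-1)^n / (2 (2n)!)`.
Here `α` is the unique positive solution of `cosh α = α sinh α` and
`X 0 < X 1 < ⋯` enumerates the positive roots of `cos t + t sin t = 0`. -/
theorem recursion_formula_for_S
    (α : ℝ) (hα_pos : 0 < α) (hα_eq : Real.cosh α = α * Real.sinh α)
    (X : ℕ → ℝ) (hX_mono : StrictMono X) (hX_pos : ∀ m, 0 < X m)
    (hX_root : ∀ m, Real.cos (X m) + X m * Real.sin (X m) = 0)
    (hX_all : ∀ t : ℝ, 0 < t → Real.cos t + t * Real.sin t = 0 → ∃ m, X m = t)
    (n : ℕ) :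
    ∑ ℓ ∈ Finset.Icc 1 (n + 1),
      ((-1 : ℝ) ^ (n + 1 - ℓ) * (2 * ((n : ℝ) + 1 - (ℓ : ℝ)) - 1) /
          (Nat.factorial (2 * (n + 1 - ℓ)))) *
        ((∑' m : ℕ, 1 / (X m) ^ (2 * ℓ)) + (-1) ^ ℓ / α ^ (2 * ℓ)) =
      (-1) ^ n / (2 * (Nat.factorial (2 * n))) := by
  obtain ⟨F, hF, hFsq, hcoeff, hsimple⟩ := exists_entire_sq_eq_cos_add_mul_sin
  have hT := tsum_add_eq_neg_iteratedDeriv_logDeriv hF hFsq hsimple hα_pos hα_eq hX_mono hX_pos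
    hX_root hX_all
  set T : ℕ → ℝ := fun ℓ ↦ (∑' m : ℕ, 1 / (X m) ^ (2 * ℓ)) + (-1) ^ ℓ / α ^ (2 * ℓ) with hTdef
  have hlog : ∀ k : ℕ, iteratedDeriv k (logDeriv F) 0 = -(k.factorial * (T (k + 1) : ℂ)) := by
    intro k
    have hk : (k.factorial : ℂ) ≠ 0 := by exact_mod_cast k.factorial_ne_zero
    rw [hTdef, hT k]
    field_simp
  have hnewton := iteratedDeriv_succ_eq_sum_logDeriv (hF.analyticAt 0)
    (by simpa using (hFsq 0).trans_ne (by simp)) n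
  have hn : (n.factorial : ℂ) ≠ 0 := by exact_mod_cast n.factorial_ne_zero
  have hterm : ∀ i ∈ Finset.range (n + 1),
      (n.choose i : ℂ) * iteratedDeriv i F 0 * iteratedDeriv (n - i) (logDeriv F) 0 =
        n.factorial *
          ((((-1 : ℝ) ^ i * (2 * i - 1) / (2 * i).factorial) * T (n + 1 - i) : ℝ) : ℂ) := by
    intro i hi
    have hin : i ≤ n := Nat.lt_succ_iff.1 (Finset.mem_range.1 hi)
    rw [hcoeff, hlog, ← Nat.choose_mul_factorial_mul_factorial hin, Nat.succ_sub hin]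
    push_cast
    ring
  have hsum : ∑ ℓ ∈ Finset.Icc 1 (n + 1),
      ((-1 : ℝ) ^ (n + 1 - ℓ) * (2 * ((n : ℝ) + 1 - (ℓ : ℝ)) - 1) /
          (Nat.factorial (2 * (n + 1 - ℓ)))) * T ℓ =
      ∑ i ∈ Finset.range (n + 1),
        ((-1 : ℝ) ^ i * (2 * i - 1) / (2 * i).factorial) * T (n + 1 - i) := by
    refine Finset.sum_nbij' (fun ℓ ↦ n + 1 - ℓ) (fun i ↦ n + 1 - i) ?_ ?_ ?_ ?_ ?_
    · intro ℓ hℓ; simp at hℓ ⊢; omega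
    · intro i hi; simp at hi ⊢; omega
    · intro ℓ hℓ; simp at hℓ ⊢; omega
    · intro i hi; simp at hi ⊢; omega
    · intro ℓ hℓ
      have hle := (Finset.mem_Icc.1 hℓ).2
      rw [Nat.sub_sub_self hle, Nat.cast_sub hle]
      push_cast
      rfl
  rw [hsum]
  rw [Finset.sum_congr rfl hterm, ← Finset.mul_sum, hcoeff, ← Complex.ofReal_sum,
    Nat.factorial_succ, show 2 * (n + 1) = 2 * n + 1 + 1 by ring, Nat.factorial_succ (2 * n + 1),
    Nat.factorial_succ (2 * n)] at hnewton
  have h2n : ((2 * n).factorial : ℂ) ≠ 0 := by exact_mod_cast Nat.factorial_ne_zero _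
  have hn1 : (n : ℂ) + 1 ≠ 0 := by exact_mod_cast n.succ_ne_zero
  have hn2 : 2 * (n : ℂ) + 1 ≠ 0 := by exact_mod_cast (2 * n).succ_ne_zero
  have hn3 : ((2 * n + 1 + 1 : ℕ) : ℂ) = 2 * (n + 1) := by push_cast; ring
  refine Complex.ofReal_injective (mul_left_cancel₀ hn (hnewton.symm.trans ?_))
  rw [Nat.cast_mul, Nat.cast_mul, Nat.cast_mul, hn3]
  push_cast
  rw [show (1 : ℂ) - 2 * (n + 1) = -(2 * n + 1) by ring, pow_succ]
  generalize (2 * (n : ℂ) + 1) = d at hn2 ⊢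
  field_simp
end
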